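/- Assume the field F is algebraically closed, and assume that for every nonnegative integer d and all scalars θ_0,…,θ_d, θ*_0,…,θ*_d in F satisfying conditions (i) and (iii) below, the associated map μ : F[x_1,…,x_d] → e*_0 T e*_0 is an isomorphism. Then for every nonnegative integer d and every sequence of scalars ({θ_i}_{i=0}^d; {θ*_i}_{i=0}^d; {ζ_i}_{i=0}^d) taken from F, there exists a tridiagonal system Φ over F with parameter array ({θ_i}_{i=0}^d; {θ*_i}_{i=0}^d; {ζ_i}_{i=0}^d) if and only if: (i) θ_i ≠ θ_j and θ*_i ≠ θ*_j whenever i ≠ j (0 ≤ i,j ≤ d); (ii) ζ_0 = 1, ζ_d ≠ 0, and Σ_{i=0}^d η_{d−i}(θ_0) η*_{d−i}(θ*_0) ζ_i ≠ 0; (iii) the expressions (θ_{i-2}−θ_{i+1})/(θ_{i-1}−θ_i) and (θ*_{i-2}−θ*_{i+1})/(θ*_{i-1}−θ*_i) are equal and independent of i for 2 ≤ i ≤ d−1. Moreover, if (i)–(iii) hold then Φ is unique up to isomorphism of tridiagonal systems. -/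

import Mathlib

open Polynomial

noncomputable section

/-- The polynomial `τ_i = (λ−θ_0)(λ−θ_1)⋯(λ−θ_{i−1})`. -/
def tauPoly {F : Type*} [Field F] (θ : ℕ → F) (i : ℕ) : Polynomial F :=
  ∏ j ∈ Finset.range i, (X - C (θ j))

/-- The polynomial `η_i = (λ−θ_d)(λ−θ_{d−1})⋯(λ−θ_{d−i+1})`. -/
def etaPoly {F : Type*} [Field F] (d : ℕ) (θ : ℕ → F) (i : ℕ) : Polynomial F :=
  ∏ j ∈ Finset.range i, (X - C (θ (d - j)))

/-- Generators of the algebra `T`: `a`, `a*`, `e_0,…,e_d`, `e*_0,…,e*_d`. -/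
inductive TGen (d : ℕ) : Type
  | a : TGen d
  | astar : TGen d
  | e : Fin (d + 1) → TGen d
  | estar : Fin (d + 1) → TGen d

/-- The defining relations of the algebra `T`. -/
inductive TRel (F : Type*) [Field F] (d : ℕ) (θ θs : ℕ → F) :
    FreeAlgebra F (TGen d) → FreeAlgebra F (TGen d) → Prop
  | ee (i j : Fin (d + 1)) :
      TRel F d θ θs (FreeAlgebra.ι F (TGen.e i) * FreeAlgebra.ι F (TGen.e j))
        (if i = j then FreeAlgebra.ι F (TGen.e i) else 0)
  | eses (i j : Fin (d + 1)) :
      TRel F d θ θs (FreeAlgebra.ι F (TGen.estar i) * FreeAlgebra.ι F (TGen.estar j))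
        (if i = j then FreeAlgebra.ι F (TGen.estar i) else 0)
  | sum_e : TRel F d θ θs (∑ i : Fin (d + 1), FreeAlgebra.ι F (TGen.e i)) 1
  | sum_estar : TRel F d θ θs (∑ i : Fin (d + 1), FreeAlgebra.ι F (TGen.estar i)) 1
  | a_eq : TRel F d θ θs (FreeAlgebra.ι F TGen.a)
      (∑ i : Fin (d + 1), θ (i : ℕ) • FreeAlgebra.ι F (TGen.e i))
  | astar_eq : TRel F d θ θs (FreeAlgebra.ι F TGen.astar)
      (∑ i : Fin (d + 1), θs (i : ℕ) • FreeAlgebra.ι F (TGen.estar i))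
  | trid (i j : Fin (d + 1)) (k : ℕ) (hk : k ≤ d)
      (h : k < max ((i : ℕ) - (j : ℕ)) ((j : ℕ) - (i : ℕ))) :
      TRel F d θ θs (FreeAlgebra.ι F (TGen.estar i) * FreeAlgebra.ι F TGen.a ^ k *
        FreeAlgebra.ι F (TGen.estar j)) 0
  | tridstar (i j : Fin (d + 1)) (k : ℕ) (hk : k ≤ d)
      (h : k < max ((i : ℕ) - (j : ℕ)) ((j : ℕ) - (i : ℕ))) :
      TRel F d θ θs (FreeAlgebra.ι F (TGen.e i) * FreeAlgebra.ι F TGen.astar ^ k *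
        FreeAlgebra.ι F (TGen.e j)) 0

/-- The `F`-algebra `T` presented by the above generators and relations. -/
abbrev TAlg (F : Type*) [Field F] (d : ℕ) (θ θs : ℕ → F) : Type _ :=
  RingQuot (TRel F d θ θs)

/-- The image in `T` of a generator. -/
def tgen (F : Type*) [Field F] (d : ℕ) (θ θs : ℕ → F) (g : TGen d) : TAlg F d θ θs :=
  RingQuot.mkAlgHom F (TRel F d θ θs) (FreeAlgebra.ι F g)

/-- The element `a` of `T`. -/
def aT (F : Type*) [Field F] (d : ℕ) (θ θs : ℕ → F) : TAlg F d θ θs :=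
  tgen F d θ θs TGen.a

/-- The element `a*` of `T`. -/
def asT (F : Type*) [Field F] (d : ℕ) (θ θs : ℕ → F) : TAlg F d θ θs :=
  tgen F d θ θs TGen.astar

/-- The element `e_i` of `T` (defined to be `0` for `i > d`). -/
def eT (F : Type*) [Field F] (d : ℕ) (θ θs : ℕ → F) (i : ℕ) : TAlg F d θ θs :=
  if h : i < d + 1 then tgen F d θ θs (TGen.e ⟨i, h⟩) else 0

/-- The element `e*_i` of `T` (defined to be `0` for `i > d`). -/
def esT (F : Type*) [Field F] (d : ℕ) (θ θs : ℕ → F) (i : ℕ) : TAlg F d θ θs :=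
  if h : i < d + 1 then tgen F d θ θs (TGen.estar ⟨i, h⟩) else 0

/-- Conditions (i) and (iii): the `θ_i` are mutually distinct, the `θ*_i` are mutually
distinct, and the expressions `(θ_{i-2}−θ_{i+1})/(θ_{i-1}−θ_i)`,
`(θ*_{i-2}−θ*_{i+1})/(θ*_{i-1}−θ*_i)` are equal and independent of `i` for `2 ≤ i ≤ d−1`. -/
def EigCond (F : Type*) [Field F] (d : ℕ) (θ θs : ℕ → F) : Prop :=
  (∀ i j, i ≤ d → j ≤ d → i ≠ j → θ i ≠ θ j) ∧
  (∀ i j, i ≤ d → j ≤ d → i ≠ j → θs i ≠ θs j) ∧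
  ∃ β : F, ∀ i, 2 ≤ i → i + 1 ≤ d →
    θ (i - 2) - θ (i + 1) = β * (θ (i - 1) - θ i) ∧
    θs (i - 2) - θs (i + 1) = β * (θs (i - 1) - θs i)

/-- The subalgebra `D` of `T` generated by `a`, as an `F`-subspace. -/
def Dsub (F : Type*) [Field F] (d : ℕ) (θ θs : ℕ → F) : Submodule F (TAlg F d θ θs) :=
  Subalgebra.toSubmodule (Algebra.adjoin F {aT F d θ θs})

/-- The subalgebra `D*` of `T` generated by `a*`, as an `F`-subspace. -/
def DsSub (F : Type*) [Field F] (d : ℕ) (θ θs : ℕ → F) : Submodule F (TAlg F d θ θs) :=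
  Subalgebra.toSubmodule (Algebra.adjoin F {asT F d θ θs})

end

noncomputable section

/-- A tridiagonal system on `V` of diameter `d`, with data `(A; {E_i}; A*; {E*_i})`,
eigenvalue sequence `θ` and dual eigenvalue sequence `θs`.  The families `E`, `Es` are the
orderings of the primitive idempotents of `A`, `A*` (so the `E_i V` are the eigenspaces of the
diagonalizable map `A`, ordered so that the tridiagonal conditions hold, and similarly for
`A*`), and the last condition is the irreducibility condition (iv). -/
def IsTDSystem (F : Type*) [Field F] (V : Type*) [AddCommGroup V] [Module F V]
    (d : ℕ) (A As : V →ₗ[F] V) (E Es : ℕ → (V →ₗ[F] V)) (θ θs : ℕ → F) : Prop :=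
  FiniteDimensional F V ∧ 0 < Module.finrank F V ∧
  (∀ i j, i ≤ d → j ≤ d → i ≠ j → θ i ≠ θ j) ∧
  (∀ i j, i ≤ d → j ≤ d → i ≠ j → θs i ≠ θs j) ∧
  (∀ i, i ≤ d → E i ≠ 0) ∧
  (∀ i, i ≤ d → Es i ≠ 0) ∧
  (∀ i j, i ≤ d → j ≤ d → E i ∘ₗ E j = if i = j then E i else 0) ∧
  (∀ i j, i ≤ d → j ≤ d → Es i ∘ₗ Es j = if i = j then Es i else 0) ∧
  (∑ i ∈ Finset.range (d + 1), E i) = LinearMap.id ∧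
  (∑ i ∈ Finset.range (d + 1), Es i) = LinearMap.id ∧
  A = ∑ i ∈ Finset.range (d + 1), θ i • E i ∧
  As = ∑ i ∈ Finset.range (d + 1), θs i • Es i ∧
  (∀ i, i ≤ d → Submodule.map As (LinearMap.range (E i)) ≤
    (if i = 0 then ⊥ else LinearMap.range (E (i - 1))) ⊔ LinearMap.range (E i) ⊔
      (if i = d then ⊥ else LinearMap.range (E (i + 1)))) ∧
  (∀ i, i ≤ d → Submodule.map A (LinearMap.range (Es i)) ≤
    (if i = 0 then ⊥ else LinearMap.range (Es (i - 1))) ⊔ LinearMap.range (Es i) ⊔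
      (if i = d then ⊥ else LinearMap.range (Es (i + 1)))) ∧
  (∀ W : Submodule F V, (∀ w ∈ W, A w ∈ W) → (∀ w ∈ W, As w ∈ W) → W = ⊥ ∨ W = ⊤)

/-- A sharp tridiagonal system with parameter array `(θ; θs; ζ)`:  a tridiagonal system
which is sharp (`dim E*_0 V = 1`) and whose split sequence is `ζ`, i.e.
`E*_0 τ_i(A) E*_0 = ζ_i E*_0 / ((θ*_0−θ*_1)⋯(θ*_0−θ*_i))` for `0 ≤ i ≤ d`. -/
def SharpTDWithArray (F : Type*) [Field F] (V : Type*) [AddCommGroup V] [Module F V]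
    (d : ℕ) (A As : V →ₗ[F] V) (E Es : ℕ → (V →ₗ[F] V)) (θ θs ζ : ℕ → F) : Prop :=
  IsTDSystem F V d A As E Es θ θs ∧
  Module.finrank F (LinearMap.range (Es 0)) = 1 ∧
  ∀ i, i ≤ d → Es 0 ∘ₗ (Polynomial.aeval A (tauPoly θ i)) ∘ₗ Es 0 =
    (ζ i / ∏ h ∈ Finset.Icc 1 i, (θs 0 - θs h)) • Es 0

/-- The action of an element `x` of `T` on a `T`-module `M`, as an `F`-linear map. -/
def actL {F : Type*} [Field F] {d : ℕ} {θ θs : ℕ → F} {M : Type*} [AddCommGroup M]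
    [Module F M] [Module (TAlg F d θ θs) M] [IsScalarTower F (TAlg F d θ θs) M]
    (x : TAlg F d θ θs) : M →ₗ[F] M where
  toFun m := x • m
  map_add' := smul_add x
  map_smul' c m := (smul_comm c x m).symm

/-- The `F`-linear map `T → M`, `t ↦ t • v`, for a vector `v` of a `T`-module `M`. -/
def applyVec {F : Type*} [Field F] {d : ℕ} {θ θs : ℕ → F} {M : Type*} [AddCommGroup M]
    [Module F M] [Module (TAlg F d θ θs) M] [IsScalarTower F (TAlg F d θ θs) M]
    (v : M) : TAlg F d θ θs →ₗ[F] M where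
  toFun t := t • v
  map_add' x y := add_smul x y v
  map_smul' c t := smul_assoc c t v

/-- The `F`-subspace `e*_0 T e*_0` of `T`. -/
def corner (F : Type*) [Field F] (d : ℕ) (θ θs : ℕ → F) : Submodule F (TAlg F d θ θs) :=
  LinearMap.range ((LinearMap.mulLeft F (esT F d θ θs 0)).comp
    (LinearMap.mulRight F (esT F d θ θs 0)))

/-- The properties characterizing the homomorphism `μ : F[x_1,…,x_d] → e*_0 T e*_0`:
it is `F`-linear, unital (with `1 ↦ e*_0`, the identity of `e*_0Te*_0`), multiplicative,
sends `x_i ↦ e*_0 τ_i(a) e*_0` for `1 ≤ i ≤ d`, and is onto `e*_0 T e*_0`. -/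
def MuProps (F : Type*) [Field F] (d : ℕ) (θ θs : ℕ → F)
    (μ : MvPolynomial (Fin d) F →ₗ[F] TAlg F d θ θs) : Prop :=
  μ 1 = esT F d θ θs 0 ∧
  (∀ p q, μ (p * q) = μ p * μ q) ∧
  (∀ i : Fin d, μ (MvPolynomial.X i) =
    esT F d θ θs 0 * (Polynomial.aeval (aT F d θ θs) (tauPoly θ ((i : ℕ) + 1))) *
      esT F d θ θs 0) ∧
  LinearMap.range μ = corner F d θ θs

/-- Conditions (ii) on the split sequence: `ζ_0 = 1`, `ζ_d ≠ 0` and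
`Σ_{i=0}^d η_{d−i}(θ_0) η*_{d−i}(θ*_0) ζ_i ≠ 0`. -/
def ZetaCond (F : Type*) [Field F] (d : ℕ) (θ θs : ℕ → F) (ζ : ℕ → F) : Prop :=
  ζ 0 = 1 ∧ ζ d ≠ 0 ∧
  (∑ i ∈ Finset.range (d + 1),
    (etaPoly d θ (d - i)).eval (θ 0) * (etaPoly d θs (d - i)).eval (θs 0) * ζ i) ≠ 0

/-- The element `g_i = e*_0 τ_i(a) e*_0 − ζ_i e*_0/((θ*_0−θ*_1)⋯(θ*_0−θ*_i))` of `T`. -/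
def gElt (F : Type*) [Field F] (d : ℕ) (θ θs : ℕ → F) (ζ : ℕ → F) (i : ℕ) :
    TAlg F d θ θs :=
  esT F d θ θs 0 * (Polynomial.aeval (aT F d θ θs) (tauPoly θ i)) * esT F d θ θs 0 -
    (ζ i / ∏ h ∈ Finset.Icc 1 i, (θs 0 - θs h)) • esT F d θ θs 0

/-- The left ideal `J = T(1−e*_0) + Σ_{i=1}^d T g_i` of `T`, as a submodule of `T` over
itself (with the left regular action). -/
def Jideal (F : Type*) [Field F] (d : ℕ) (θ θs : ℕ → F) (ζ : ℕ → F) :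
    Submodule (TAlg F d θ θs) (TAlg F d θ θs) :=
  Submodule.span (TAlg F d θ θs)
    ({1 - esT F d θ θs 0} ∪ (gElt F d θ θs ζ '' Set.Icc 1 d))

/-- The `F`-subspace `D D* D D* D ⋯ D D* D` of `T` with `n+1` factors `D`. -/
def DDchain (F : Type*) [Field F] (d : ℕ) (θ θs : ℕ → F) : ℕ → Submodule F (TAlg F d θ θs)
  | 0 => Dsub F d θ θs
  | n + 1 => DDchain F d θ θs n * DsSub F d θ θs * Dsub F d θ θs

/-- The `F`-subspace `e*_r D e*_{κ 1} D e*_{κ 2} ⋯ D e*_{κ m}` of `T`. -/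
def esChain (F : Type*) [Field F] (d : ℕ) (θ θs : ℕ → F) (r : ℕ) (κ : ℕ → ℕ) :
    ℕ → Submodule F (TAlg F d θ θs)
  | 0 => Submodule.span F {esT F d θ θs r}
  | m + 1 => esChain F d θ θs r κ m * Dsub F d θ θs *
      Submodule.span F {esT F d θ θs (κ (m + 1))}

/-- The sequence `(c_0, c_1, …, c_m)` is convex: `c_{i−1} − c_i ≥ c_i − c_{i+1}`
for `1 ≤ i ≤ m−1`. -/
def ConvexSeq (c : ℕ → ℤ) (m : ℕ) : Prop :=
  ∀ i, 1 ≤ i → i + 1 ≤ m → c i - c (i + 1) ≤ c (i - 1) - c i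

end

section TDAlgebra

variable {F : Type*} [Field F] {R : Type*} [Ring R] [Algebra F R] {d : ℕ} {θ θs : ℕ → F}
  {e es : ℕ → R}

/-- The combination `∑ i ≤ d, θ i • e i`. -/
def specOp (d : ℕ) (θ : ℕ → F) (e : ℕ → R) : R := ∑ i ∈ Finset.range (d + 1), θ i • e i

/-- The defining relations of the algebra `T`, for elements of an arbitrary algebra. -/
structure TDRel (d : ℕ) (θ θs : ℕ → F) (e es : ℕ → R) : Prop where
  e_mul : ∀ i j, i ≤ d → j ≤ d → e i * e j = if i = j then e i else 0
  es_mul : ∀ i j, i ≤ d → j ≤ d → es i * es j = if i = j then es i else 0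
  sum_e : ∑ i ∈ Finset.range (d + 1), e i = 1
  sum_es : ∑ i ∈ Finset.range (d + 1), es i = 1
  es_pow : ∀ i j, i ≤ d → j ≤ d → ∀ k, k < max (i - j) (j - i) →
    es i * specOp d θ e ^ k * es j = 0
  e_pow : ∀ i j, i ≤ d → j ≤ d → ∀ k, k < max (i - j) (j - i) →
    e i * specOp d θs es ^ k * e j = 0

namespace TDRel

theorem swap (h : TDRel d θ θs e es) : TDRel d θs θ es e :=
  ⟨h.es_mul, h.e_mul, h.sum_es, h.sum_e, h.e_pow, h.es_pow⟩

theorem map {R' : Type*} [Ring R'] [Algebra F R'] (h : TDRel d θ θs e es) (ρ : R →ₐ[F] R') :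
    TDRel d θ θs (fun i => ρ (e i)) (fun i => ρ (es i)) := by
  have hop : ∀ (η : ℕ → F) (x : ℕ → R),
      specOp d η (fun i => ρ (x i)) = ρ (specOp d η x) := by
    intro η x; simp [specOp, map_sum]
  refine ⟨?_, ?_, ?_, ?_, ?_, ?_⟩
  · intro i j hi hj
    rw [← map_mul, h.e_mul i j hi hj]; split_ifs <;> simp
  · intro i j hi hj
    rw [← map_mul, h.es_mul i j hi hj]; split_ifs <;> simp
  · rw [← map_sum, h.sum_e, map_one]
  · rw [← map_sum, h.sum_es, map_one]
  · intro i j hi hj k hk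
    rw [hop, ← map_pow, ← map_mul, ← map_mul, h.es_pow i j hi hj k hk, map_zero]
  · intro i j hi hj k hk
    rw [hop, ← map_pow, ← map_mul, ← map_mul, h.e_pow i j hi hj k hk, map_zero]

theorem specOp_mul (h : TDRel d θ θs e es) {j : ℕ} (hj : j ≤ d) :
    specOp d θ e * e j = θ j • e j := by
  rw [specOp, Finset.sum_mul, Finset.sum_eq_single j]
  · rw [smul_mul_assoc, h.e_mul j j hj hj, if_pos rfl]
  · intro i hi hij
    rw [smul_mul_assoc, h.e_mul i j (by simpa [Nat.lt_succ_iff] using hi) hj, if_neg hij, smul_zero]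
  · intro hj'; simp at hj'; omega

theorem mul_specOp (h : TDRel d θ θs e es) {j : ℕ} (hj : j ≤ d) :
    e j * specOp d θ e = θ j • e j := by
  rw [specOp, Finset.mul_sum, Finset.sum_eq_single j]
  · rw [mul_smul_comm, h.e_mul j j hj hj, if_pos rfl]
  · intro i hi hij
    rw [mul_smul_comm, h.e_mul j i hj (by simpa [Nat.lt_succ_iff] using hi), if_neg hij.symm,
      smul_zero]
  · intro hj'; simp at hj'; omega

theorem aeval_mul (h : TDRel d θ θs e es) (f : F[X]) {j : ℕ} (hj : j ≤ d) :
    aeval (specOp d θ e) f * e j = f.eval (θ j) • e j := by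
  induction f using Polynomial.induction_on with
  | C c => simp [Algebra.smul_def]
  | add p q hp hq => simp [add_mul, hp, hq, add_smul]
  | monomial n c ih =>
    rw [pow_succ, ← mul_assoc, map_mul, aeval_X, mul_assoc, h.specOp_mul hj, mul_smul_comm, ih,
      smul_smul, eval_mul (q := X), eval_X, mul_comm]

theorem aeval_eq_sum (h : TDRel d θ θs e es) (f : F[X]) :
    aeval (specOp d θ e) f = ∑ i ∈ Finset.range (d + 1), f.eval (θ i) • e i := by
  conv_lhs => rw [← mul_one (aeval _ f), ← h.sum_e, Finset.mul_sum]
  refine Finset.sum_congr rfl fun i hi => h.aeval_mul f ?_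
  simpa [Nat.lt_succ_iff] using hi

theorem mul_aeval (h : TDRel d θ θs e es) (f : F[X]) {j : ℕ} (hj : j ≤ d) :
    e j * aeval (specOp d θ e) f = f.eval (θ j) • e j := by
  rw [h.aeval_eq_sum, Finset.mul_sum, Finset.sum_eq_single j]
  · rw [mul_smul_comm, h.e_mul j j hj hj, if_pos rfl]
  · intro i hi hij
    rw [mul_smul_comm, h.e_mul j i hj (by simpa [Nat.lt_succ_iff] using hi), if_neg hij.symm,
      smul_zero]
  · intro hj'; simp at hj'; omega

theorem es_aeval_es (h : TDRel d θ θs e es) {i j : ℕ} (hi : i ≤ d) (hj : j ≤ d) (f : F[X])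
    (hf : f.natDegree < max (i - j) (j - i)) :
    es i * aeval (specOp d θ e) f * es j = 0 := by
  rw [Polynomial.aeval_eq_sum_range, Finset.mul_sum, Finset.sum_mul]
  refine Finset.sum_eq_zero fun k hk => ?_
  rw [mul_smul_comm, smul_mul_assoc, h.es_pow i j hi hj k, smul_zero]
  exact lt_of_le_of_lt (by simpa [Nat.lt_succ_iff] using hk) hf

end TDRel

variable {M : Type*} [AddCommGroup M] [Module F M]

theorem eq_zero_of_sum_eval_smul_eq_zero (hθ : ∀ i j, i ≤ d → j ≤ d → i ≠ j → θ i ≠ θ j)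
    (x : ℕ → M) (S : Finset ℕ) (hS : S ⊆ Finset.range (d + 1))
    (hsupp : ∀ i, i ≤ d → i ∉ S → x i = 0)
    (hkill : ∀ f : F[X], f.natDegree < S.card →
      ∑ i ∈ Finset.range (d + 1), f.eval (θ i) • x i = 0) :
    ∀ i, i ≤ d → x i = 0 := by
  intro i hi
  by_cases hiS : i ∈ S
  swap
  · exact hsupp i hi hiS
  have hdeg : (∏ j ∈ S.erase i, (X - C (θ j))).natDegree < S.card := by
    rw [Polynomial.natDegree_finsetProd_X_sub_C_eq_card]
    exact Finset.card_erase_lt_of_mem hiS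
  have h := hkill _ hdeg
  rw [Finset.sum_eq_single i] at h
  · refine (smul_eq_zero.mp h).resolve_left ?_
    rw [eval_prod]
    refine Finset.prod_ne_zero_iff.mpr fun j hj => ?_
    have hj' := Finset.mem_erase.mp hj
    have := Finset.mem_range.mp (hS hj'.2)
    simpa [sub_eq_zero] using hθ i j hi (by omega) (Ne.symm hj'.1)
  · intro j hj hji
    by_cases hjS : j ∈ S
    · rw [eval_prod, Finset.prod_eq_zero (Finset.mem_erase.mpr ⟨hji, hjS⟩) (by simp), zero_smul]
    · rw [hsupp j (by simpa [Nat.lt_succ_iff] using hj) hjS, smul_zero]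
  · intro hi'; simp at hi'; omega

/-- A banded matrix of bandwidth `k` whose columns (rows) are orthogonal to all polynomials of
degree less than `p` (less than `q`) is zero if `2 * k < p + q`, or if `p = q = k` and its diagonal
is zero. -/
theorem banded_eq_zero (hθ : ∀ i j, i ≤ d → j ≤ d → i ≠ j → θ i ≠ θ j)
    (B : ℕ → ℕ → M) (k p q : ℕ)
    (hband : ∀ i j, i ≤ d → j ≤ d → k < max (i - j) (j - i) → B i j = 0)
    (hl : ∀ f : F[X], f.natDegree < p → ∀ j, j ≤ d →
      ∑ i ∈ Finset.range (d + 1), f.eval (θ i) • B i j = 0)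
    (hr : ∀ f : F[X], f.natDegree < q → ∀ i, i ≤ d →
      ∑ j ∈ Finset.range (d + 1), f.eval (θ j) • B i j = 0)
    (h : 2 * k < p + q ∨ (p = k ∧ q = k ∧ ∀ j, j ≤ d → B j j = 0)) :
    ∀ j i, i ≤ d → j ≤ d → B i j = 0 := by
  intro j
  induction j using Nat.strong_induction_on with
  | _ j ih =>
  intro i hi hj
  have hrow : ∀ i, i ≤ d → i + k + 1 ≤ q + j → B i j = 0 := by
    intro i hi hij
    refine eq_zero_of_sum_eval_smul_eq_zero hθ (fun j' => B i j')
      (Finset.Ico j (i + k + 1) ∩ Finset.range (d + 1)) Finset.inter_subset_right ?_ ?_ j hj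
    · intro j' hj' hn
      simp only [Finset.mem_inter, Finset.mem_Ico, Finset.mem_range] at hn
      by_cases hjj : j' < j
      · exact ih j' hjj i hi hj'
      · exact hband i j' hi hj' (by omega)
    · intro f hf
      refine hr f (lt_of_lt_of_le hf ?_) i hi
      refine (Finset.card_le_card Finset.inter_subset_left).trans ?_
      rw [Nat.card_Ico]; omega
  rcases h with h | ⟨hp, hq, hd⟩
  · refine eq_zero_of_sum_eval_smul_eq_zero hθ (fun i' => B i' j)
      (Finset.Ico (q + j - k) (j + k + 1) ∩ Finset.range (d + 1)) Finset.inter_subset_right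
      ?_ ?_ i hi
    · intro i' hi' hn
      simp only [Finset.mem_inter, Finset.mem_Ico, Finset.mem_range] at hn
      by_cases hjj : i' + k + 1 ≤ q + j
      · exact hrow i' hi' hjj
      · exact hband i' j hi' hj (by omega)
    · intro f hf
      refine hl f (lt_of_lt_of_le hf ?_) j hj
      refine (Finset.card_le_card Finset.inter_subset_left).trans ?_
      rw [Nat.card_Ico]; omega
  · refine eq_zero_of_sum_eval_smul_eq_zero hθ (fun i' => B i' j)
      (Finset.Ico (j + 1) (j + k + 1) ∩ Finset.range (d + 1)) Finset.inter_subset_right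
      ?_ ?_ i hi
    · intro i' hi' hn
      simp only [Finset.mem_inter, Finset.mem_Ico, Finset.mem_range] at hn
      rcases lt_trichotomy i' j with hlt | rfl | hgt
      · exact hrow i' hi' (by omega)
      · exact hd i' hi'
      · exact hband i' j hi' hj (by omega)
    · intro f hf
      refine hl f (lt_of_lt_of_le hf ?_) j hj
      refine (Finset.card_le_card Finset.inter_subset_left).trans ?_
      rw [Nat.card_Ico]; omega

namespace TDRel

theorem mul_aeval_mul_eq_sum (h : TDRel d θ θs e es) (x y : R) (f : F[X]) :
    x * aeval (specOp d θ e) f * y =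
      ∑ i ∈ Finset.range (d + 1), f.eval (θ i) • (x * e i * y) := by
  simp [h.aeval_eq_sum, Finset.mul_sum, Finset.sum_mul]

theorem eval_prod_X_sub_C_ne_zero (hθ : ∀ i j, i ≤ d → j ≤ d → i ≠ j → θ i ≠ θ j)
    {s u : ℕ} (hu : u ≤ d) : (∏ j ∈ Finset.Ico s u, (X - C (θ j))).eval (θ u) ≠ 0 := by
  rw [eval_prod, Finset.prod_ne_zero_iff]
  intro j hj
  have := Finset.mem_Ico.mp hj
  simpa [sub_eq_zero] using hθ u j hu (by omega) (by omega)

theorem eval_prod_X_sub_C_eq_zero {s u j : ℕ} (h1 : s ≤ j) (h2 : j < u) :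
    (∏ j ∈ Finset.Ico s u, (X - C (θ j))).eval (θ j) = 0 := by
  rw [eval_prod, Finset.prod_eq_zero (Finset.mem_Ico.mpr ⟨h1, h2⟩) (by simp)]

/-- The sandwich `e*_r e_i e*_u e_j e*_t` can be reduced to those with `2 * u ≤ r + t`. -/
theorem mem_of_forall_lt_mem (h : TDRel d θ θs e es)
    (hθ : ∀ i j, i ≤ d → j ≤ d → i ≠ j → θ i ≠ θ j)
    (hθs : ∀ i j, i ≤ d → j ≤ d → i ≠ j → θs i ≠ θs j)
    {r s t : ℕ} (hr : r ≤ d) (ht : t ≤ d) (hrst : r + t < 2 * s) (W : Submodule F R)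
    (hW : ∀ u, u < s → ∀ i j, i ≤ d → j ≤ d → es r * e i * es u * e j * es t ∈ W) :
    ∀ n u, u + n = d → ∀ i j, i ≤ d → j ≤ d → es r * e i * es u * e j * es t ∈ W := by
  intro n
  induction n using Nat.strong_induction_on with
  | _ n ih =>
  intro u hun i j hi hj
  have hu : u ≤ d := by omega
  by_cases hus : u < s
  · exact hW u hus i j hi hj
  push Not at hus
  set f : F[X] := ∏ j ∈ Finset.Ico s u, (X - C (θs j)) with hf
  have hfu : f.eval (θs u) ≠ 0 := eval_prod_X_sub_C_ne_zero hθs hu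
  have hfdeg : f.natDegree = u - s := by
    rw [hf, Polynomial.natDegree_finsetProd_X_sub_C_eq_card, Nat.card_Ico]
  have key : ∀ i j, i ≤ d → j ≤ d → W.mkQ (es r * e i * aeval (specOp d θs es) f * (e j * es t)) =
      f.eval (θs u) • W.mkQ (es r * e i * es u * e j * es t) := by
    intro i j hi hj
    rw [h.swap.mul_aeval_mul_eq_sum, map_sum, Finset.sum_eq_single u]
    · simp [mul_assoc]
    · intro v hv hvu
      simp only [Finset.mem_range] at hv
      rw [map_smul]
      rcases lt_or_gt_of_ne hvu with hlt | hgt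
      · by_cases hvs : v < s
        · have := hW v hvs i j hi hj
          rw [← mul_assoc, (Submodule.Quotient.mk_eq_zero W).mpr this |> fun x => (x :
            W.mkQ _ = 0), smul_zero]
        · rw [hf, eval_prod_X_sub_C_eq_zero (by omega) hlt, zero_smul]
      · have := ih (d - v) (by omega) v (by omega) i j hi hj
        rw [← mul_assoc, (Submodule.Quotient.mk_eq_zero W).mpr this |> fun x => (x :
            W.mkQ _ = 0), smul_zero]
    · intro hu'; simp at hu'; omega
  have hz := banded_eq_zero hθ (fun i j => W.mkQ (es r * e i * es u * e j * es t)) (u - s)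
    (max (r - u) (u - r)) (max (u - t) (t - u)) ?_ ?_ ?_ (Or.inl (by omega)) j i hi hj
  · exact (Submodule.Quotient.mk_eq_zero W).mp hz
  · intro i j hi hj hij
    refine (smul_eq_zero.mp ((key i j hi hj).symm.trans ?_)).resolve_left hfu
    rw [show es r * e i * aeval (specOp d θs es) f * (e j * es t) =
      es r * (e i * aeval (specOp d θs es) f * e j) * es t by simp only [mul_assoc],
      h.swap.es_aeval_es hi hj f (by omega)]
    simp
  · intro g hg j hj
    have := h.mul_aeval_mul_eq_sum (es r) (es u * (e j * es t)) g
    rw [← mul_assoc, h.es_aeval_es hr hu g hg, zero_mul] at this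
    simp only [mul_assoc] at this ⊢
    simp only [← map_smul, ← map_sum, ← this, map_zero]
  · intro g hg i hi
    have := h.mul_aeval_mul_eq_sum (es r * e i * es u) (es t) g
    rw [mul_assoc, mul_assoc _ (es u), ← mul_assoc (es u), h.es_aeval_es hu ht g hg,
      mul_zero] at this
    simp only [← map_smul, ← map_sum, ← this, map_zero]

theorem sandwich_comm (h : TDRel d θ θs e es)
    (hθ : ∀ i j, i ≤ d → j ≤ d → i ≠ j → θ i ≠ θ j)
    (hθs : ∀ i j, i ≤ d → j ≤ d → i ≠ j → θs i ≠ θs j) :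
    ∀ n u, u + n = d → ∀ i j, i ≤ d → j ≤ d →
      es 0 * e i * es u * e j * es 0 = es 0 * e j * es u * e i * es 0 := by
  intro n
  induction n using Nat.strong_induction_on with
  | _ n ih =>
  intro u hun i j hi hj
  have hu : u ≤ d := by omega
  set f : F[X] := ∏ j ∈ Finset.Ico 0 u, (X - C (θs j)) with hf
  have hfu : f.eval (θs u) ≠ 0 := eval_prod_X_sub_C_ne_zero hθs hu
  have hfdeg : f.natDegree = u := by
    rw [hf, Polynomial.natDegree_finsetProd_X_sub_C_eq_card, Nat.card_Ico, Nat.sub_zero]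
  have key : ∀ i j, i ≤ d → j ≤ d →
      es 0 * e i * aeval (specOp d θs es) f * (e j * es 0) -
        es 0 * e j * aeval (specOp d θs es) f * (e i * es 0) =
      f.eval (θs u) • (es 0 * e i * es u * e j * es 0 - es 0 * e j * es u * e i * es 0) := by
    intro i j hi hj
    rw [h.swap.mul_aeval_mul_eq_sum, h.swap.mul_aeval_mul_eq_sum, ← Finset.sum_sub_distrib,
      Finset.sum_eq_single u]
    · simp [mul_assoc, smul_sub]
    · intro v hv hvu
      simp only [Finset.mem_range] at hv
      rw [← smul_sub]
      rcases lt_or_gt_of_ne hvu with hlt | hgt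
      · rw [hf, eval_prod_X_sub_C_eq_zero (by omega) hlt, zero_smul]
      · have := ih (d - v) (by omega) v (by omega) i j hi hj
        rw [← mul_assoc, ← mul_assoc, this, sub_self, smul_zero]
    · intro hu'; simp at hu'; omega
  have hl : ∀ g : F[X], g.natDegree < u → ∀ j, ∑ i ∈ Finset.range (d + 1),
      g.eval (θ i) • (es 0 * e i * es u * e j * es 0) = 0 := by
    intro g hg j
    have := h.mul_aeval_mul_eq_sum (es 0) (es u * (e j * es 0)) g
    rw [← mul_assoc, h.es_aeval_es (Nat.zero_le d) hu g (by omega), zero_mul] at this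
    simpa only [mul_assoc] using this.symm
  have hr : ∀ g : F[X], g.natDegree < u → ∀ i, ∑ j ∈ Finset.range (d + 1),
      g.eval (θ j) • (es 0 * e i * es u * e j * es 0) = 0 := by
    intro g hg i
    have := h.mul_aeval_mul_eq_sum (es 0 * e i * es u) (es 0) g
    rw [mul_assoc, mul_assoc _ (es u), ← mul_assoc (es u),
      h.es_aeval_es hu (Nat.zero_le d) g (by omega), mul_zero] at this
    exact this.symm
  refine sub_eq_zero.mp (banded_eq_zero hθ
    (fun i j => es 0 * e i * es u * e j * es 0 - es 0 * e j * es u * e i * es 0) u u u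
    ?_ ?_ ?_ (Or.inr ⟨rfl, rfl, fun j _ => sub_self _⟩) j i hi hj)
  · intro i j hi hj hij
    refine (smul_eq_zero.mp ((key i j hi hj).symm.trans ?_)).resolve_left hfu
    have h1 : ∀ i j, i ≤ d → j ≤ d → u < max (i - j) (j - i) →
        es 0 * e i * aeval (specOp d θs es) f * (e j * es 0) = 0 := by
      intro i j hi hj hij
      rw [show es 0 * e i * aeval (specOp d θs es) f * (e j * es 0) =
        es 0 * (e i * aeval (specOp d θs es) f * e j) * es 0 by simp only [mul_assoc],
        h.swap.es_aeval_es hi hj f (by omega)]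
      simp
    rw [h1 i j hi hj hij, h1 j i hj hi (by omega), sub_zero]
  · intro g hg j hj
    simp only [smul_sub, Finset.sum_sub_distrib, hl g hg, hr g hg, sub_zero]
  · intro g hg j hj
    simp only [smul_sub, Finset.sum_sub_distrib, hl g hg, hr g hg, sub_zero]

end TDRel

end TDAlgebra

section Corner

variable {F : Type*} [Field F] {R : Type*} [Ring R] [Algebra F R] {d : ℕ} {θ θs : ℕ → F}
  {e es : ℕ → R}

open scoped IsMulCommutative in
/-- Evaluation of multivariate polynomials at commuting elements of a noncommutative algebra. -/
theorem exists_mvPolynomial_algHom {σ : Type*} (y : σ → R) (hy : ∀ i j, y i * y j = y j * y i) :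
    ∃ φ : MvPolynomial σ F →ₐ[F] R, ∀ i, φ (MvPolynomial.X i) = y i := by
  have := Algebra.isMulCommutative_adjoin F (s := Set.range y) (by
    rintro _ ⟨i, rfl⟩ _ ⟨j, rfl⟩; exact hy i j)
  refine ⟨(Algebra.adjoin F (Set.range y)).val.comp
    (MvPolynomial.aeval (S₁ := Algebra.adjoin F (Set.range y)) fun i => ⟨y i, Algebra.subset_adjoin ⟨i, rfl⟩⟩), fun i => ?_⟩
  simp

/-- The subspaces spanned by the products `e*_r e_i e*_u e_j ⋯ x` with `r > u > ⋯ > 0` and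
`x ∈ N`. -/
def chainSpan (F : Type*) [Field F] {R : Type*} [Ring R] [Algebra F R] (d : ℕ) (e es : ℕ → R)
    (N : Submodule F R) : ℕ → Submodule F R
  | 0 => N
  | r + 1 => ⨆ u : Fin (r + 1), ⨆ i : Fin (d + 1),
      (chainSpan F d e es N u).map (LinearMap.mulLeft F (es (r + 1) * e i))
termination_by r => r
decreasing_by exact u.2

theorem finiteDimensional_map_chainSpan {M : Type*} [AddCommGroup M] [Module F M]
    (N : Submodule F R) (L : R → Module.End F M) (f : R →ₗ[F] M) (hf : ∀ x y, f (x * y) = L x (f y))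
    (hN : FiniteDimensional F (N.map f)) (r : ℕ) :
    FiniteDimensional F ((chainSpan F d e es N r).map f) := by
  induction r using Nat.strong_induction_on with
  | _ r ih =>
  cases r with
  | zero => rwa [chainSpan]
  | succ r =>
    rw [chainSpan]
    have : ∀ (u : Fin (r + 1)) (i : Fin (d + 1)), FiniteDimensional F
        (((chainSpan F d e es N u).map (LinearMap.mulLeft F (es (r + 1) * e i))).map f) := by
      intro u i
      have h1 : ((chainSpan F d e es N u).map (LinearMap.mulLeft F (es (r + 1) * e i))).map f =
          ((chainSpan F d e es N u).map f).map (L (es (r + 1) * e i)) := by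
        rw [← Submodule.map_comp, ← Submodule.map_comp]
        congr 1
        ext x
        exact hf _ _
      have := ih u u.2
      rw [h1]
      infer_instance
    rw [Submodule.map_iSup, iSup_congr fun u => Submodule.map_iSup f _]
    infer_instance

namespace TDRel

theorem aeval_tauPoly_succ_eq_zero (h : TDRel d θ θs e es) :
    aeval (specOp d θ e) (tauPoly θ (d + 1)) = 0 := by
  rw [h.aeval_eq_sum]
  refine Finset.sum_eq_zero fun i hi => ?_
  rw [tauPoly, eval_prod, Finset.prod_eq_zero hi (by simp), zero_smul]

theorem aeval_corner_comm (h : TDRel d θ θs e es)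
    (hθ : ∀ i j, i ≤ d → j ≤ d → i ≠ j → θ i ≠ θ j)
    (hθs : ∀ i j, i ≤ d → j ≤ d → i ≠ j → θs i ≠ θs j) (f g : F[X]) :
    es 0 * aeval (specOp d θ e) f * es 0 * (es 0 * aeval (specOp d θ e) g * es 0) =
      es 0 * aeval (specOp d θ e) g * es 0 * (es 0 * aeval (specOp d θ e) f * es 0) := by
  have h0 : es 0 * es 0 = es 0 := by simpa using h.es_mul 0 0 (Nat.zero_le d) (Nat.zero_le d)
  have key : ∀ f g : F[X],
      es 0 * aeval (specOp d θ e) f * es 0 * (es 0 * aeval (specOp d θ e) g * es 0) =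
      ∑ i ∈ Finset.range (d + 1), ∑ j ∈ Finset.range (d + 1),
        (f.eval (θ i) * g.eval (θ j)) • (es 0 * e i * es 0 * e j * es 0) := by
    intro f g
    rw [h.mul_aeval_mul_eq_sum, h.mul_aeval_mul_eq_sum, Finset.sum_mul_sum]
    refine Finset.sum_congr rfl fun i _ => Finset.sum_congr rfl fun j _ => ?_
    rw [smul_mul_smul_comm]
    congr 1
    simp only [mul_assoc]
    rw [← mul_assoc (es 0) (es 0), h0]
  rw [key, key, Finset.sum_comm]
  refine Finset.sum_congr rfl fun i hi => Finset.sum_congr rfl fun j hj => ?_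
  rw [mul_comm, h.sandwich_comm hθ hθs d 0 (zero_add d) j i
    (by simpa [Nat.lt_succ_iff] using hj) (by simpa [Nat.lt_succ_iff] using hi)]

/-- The homomorphism `μ` from the polynomial algebra to the corner algebra. -/
theorem exists_mu (h : TDRel d θ θs e es)
    (hθ : ∀ i j, i ≤ d → j ≤ d → i ≠ j → θ i ≠ θ j)
    (hθs : ∀ i j, i ≤ d → j ≤ d → i ≠ j → θs i ≠ θs j) :
    ∃ μ : MvPolynomial (Fin d) F →ₗ[F] R, μ 1 = es 0 ∧ (∀ p q, μ (p * q) = μ p * μ q) ∧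
      (∀ i : Fin d, μ (MvPolynomial.X i) =
        es 0 * aeval (specOp d θ e) (tauPoly θ ((i : ℕ) + 1)) * es 0) := by
  have h0 : es 0 * es 0 = es 0 := by simpa using h.es_mul 0 0 (Nat.zero_le d) (Nat.zero_le d)
  obtain ⟨φ, hφ⟩ := exists_mvPolynomial_algHom (F := F) (fun i : Fin d =>
    es 0 * aeval (specOp d θ e) (tauPoly θ ((i : ℕ) + 1)) * es 0)
    (fun i j => h.aeval_corner_comm hθ hθs _ _)
  have hcomm : ∀ p, es 0 * φ p = φ p * es 0 := by
    intro p
    induction p using MvPolynomial.induction_on with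
    | C c =>
      rw [← MvPolynomial.algebraMap_eq, AlgHom.commutes]
      exact (Algebra.commutes c (es 0)).symm
    | add p q hp hq => rw [map_add, mul_add, add_mul, hp, hq]
    | mul_X p i hp =>
      rw [map_mul, hφ, ← mul_assoc, hp]
      simp only [mul_assoc, h0]
      rw [← mul_assoc (es 0) (es 0), h0]
  refine ⟨(LinearMap.mulRight F (es 0)).comp φ.toLinearMap, ?_, ?_, ?_⟩
  · simp
  · intro p q
    simp only [LinearMap.comp_apply, LinearMap.mulRight_apply, AlgHom.toLinearMap_apply, map_mul]
    rw [mul_assoc (φ p) (es 0), ← mul_assoc (es 0), hcomm q]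
    simp only [mul_assoc, h0]
  · intro i
    simp only [LinearMap.comp_apply, LinearMap.mulRight_apply, AlgHom.toLinearMap_apply, hφ]
    rw [mul_assoc, h0]

section

variable (h : TDRel d θ θs e es) (hθ : ∀ i j, i ≤ d → j ≤ d → i ≠ j → θ i ≠ θ j)
  (hθs : ∀ i j, i ≤ d → j ≤ d → i ≠ j → θs i ≠ θs j)
  {μ : MvPolynomial (Fin d) F →ₗ[F] R} (hμ1 : μ 1 = es 0) (hμm : ∀ p q, μ (p * q) = μ p * μ q)
  (hμX : ∀ i : Fin d, μ (MvPolynomial.X i) =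
    es 0 * aeval (specOp d θ e) (tauPoly θ ((i : ℕ) + 1)) * es 0)

include h hμ1 hμX in
theorem corner_aeval_mem_range (f : F[X]) :
    es 0 * aeval (specOp d θ e) f * es 0 ∈ LinearMap.range μ := by
  have h0 : es 0 * es 0 = es 0 := by simpa using h.es_mul 0 0 (Nat.zero_le d) (Nat.zero_le d)
  have key : ∀ n j, j + n = d + 1 → ∀ f : F[X],
      es 0 * aeval (specOp d θ e) (tauPoly θ j * f) * es 0 ∈ LinearMap.range μ := by
    intro n
    induction n with
    | zero =>
      intro j hj f
      rw [show j = d + 1 by omega, map_mul, h.aeval_tauPoly_succ_eq_zero]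
      simp
    | succ n ih =>
      intro j hj f
      have hf : tauPoly θ j * f = f.eval (θ j) • tauPoly θ j +
          tauPoly θ (j + 1) * (f /ₘ (X - C (θ j))) := by
        conv_lhs => rw [← Polynomial.modByMonic_add_div f (X - C (θ j)),
          Polynomial.modByMonic_X_sub_C_eq_C_eval]
        rw [tauPoly, tauPoly, Finset.prod_range_succ, Polynomial.smul_eq_C_mul]
        ring
      rw [hf, map_add, mul_add, add_mul, map_smul, mul_smul_comm, smul_mul_assoc]
      refine Submodule.add_mem _ (Submodule.smul_mem _ _ ?_) (ih (j + 1) (by omega) _)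
      cases j with
      | zero => exact ⟨1, by simp [tauPoly, hμ1, h0]⟩
      | succ j => exact ⟨MvPolynomial.X ⟨j, by omega⟩, hμX _⟩
  simpa [tauPoly] using key (d + 1) 0 (by omega) f

include hμ1 hμm in
theorem es_zero_mul_mu (p : MvPolynomial (Fin d) F) : es 0 * μ p = μ p := by
  rw [← hμ1, ← hμm, one_mul]

include hμ1 hμm in
theorem mu_mul_es_zero (p : MvPolynomial (Fin d) F) : μ p * es 0 = μ p := by
  rw [← hμ1, ← hμm, mul_one]

theorem exists_eval_eq_ite (hθ : ∀ i j, i ≤ d → j ≤ d → i ≠ j → θ i ≠ θ j) {i : ℕ} (hi : i ≤ d) :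
    ∃ f : F[X], ∀ j, j ≤ d → f.eval (θ j) = if j = i then 1 else 0 := by
  refine ⟨Lagrange.basis (Finset.range (d + 1)) θ i, fun j hj => ?_⟩
  have hinj : Set.InjOn θ (Finset.range (d + 1)) := by
    intro a ha b hb hab
    simp only [Finset.coe_range, Set.mem_Iio] at ha hb
    by_contra hne
    exact hθ a b (by omega) (by omega) hne hab
  split_ifs with hji
  · subst hji
    exact Lagrange.eval_basis_self hinj (by simp; omega)
  · exact Lagrange.eval_basis_of_ne (Ne.symm hji) (by simp; omega)

include h hθ in
theorem exists_aeval_eq {i : ℕ} (hi : i ≤ d) : ∃ f : F[X], aeval (specOp d θ e) f = e i := by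
  obtain ⟨f, hf⟩ := exists_eval_eq_ite hθ hi
  refine ⟨f, ?_⟩
  rw [h.aeval_eq_sum, Finset.sum_eq_single i]
  · rw [hf i hi, if_pos rfl, one_smul]
  · intro j hj hji
    rw [hf j (by simpa [Nat.lt_succ_iff] using hj), if_neg hji, zero_smul]
  · intro hi'; simp at hi'; omega

include h hμ1 hμm in
theorem es_mul_chainSpan {r : ℕ} (hr : r ≤ d) {x : R}
    (hx : x ∈ chainSpan F d e es (LinearMap.range μ) r) : es r * x = x := by
  cases r with
  | zero =>
    rw [chainSpan] at hx
    obtain ⟨p, rfl⟩ := hx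
    exact es_zero_mul_mu hμ1 hμm p
  | succ r =>
    rw [chainSpan] at hx
    suffices (⨆ u : Fin (r + 1), ⨆ i : Fin (d + 1), (chainSpan F d e es (LinearMap.range μ) u).map
        (LinearMap.mulLeft F (es (r + 1) * e i))) ≤
        LinearMap.ker (LinearMap.mulLeft F (es (r + 1)) - LinearMap.id) by
      simpa [sub_eq_zero] using this hx
    refine iSup_le fun u => iSup_le fun i => ?_
    rintro _ ⟨y, -, rfl⟩
    have := h.es_mul (r + 1) (r + 1) hr hr
    rw [if_pos rfl] at this
    simp [← mul_assoc, this]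

include h hθ hθs hμ1 hμm hμX in
theorem mul_mem_chainSpan {r : ℕ} (hr : r ≤ d) : ∀ s i, s ≤ d → i ≤ d →
    ∀ x ∈ chainSpan F d e es (LinearMap.range μ) r,
      es s * e i * x ∈ chainSpan F d e es (LinearMap.range μ) s := by
  induction r using Nat.strong_induction_on with
  | _ r ih =>
  intro s i hs hi x hx
  by_cases hrs : r < s
  · obtain ⟨s, rfl⟩ : ∃ s', s = s' + 1 := ⟨s - 1, by omega⟩
    rw [chainSpan.eq_def F d e es _ (s + 1)]
    refine Submodule.mem_iSup_of_mem ⟨r, hrs⟩ (Submodule.mem_iSup_of_mem ⟨i, by omega⟩ ?_)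
    exact ⟨x, hx, rfl⟩
  cases r with
  | zero =>
    obtain rfl : s = 0 := by omega
    rw [chainSpan] at hx ⊢
    obtain ⟨p, rfl⟩ := hx
    obtain ⟨f, hf⟩ := h.exists_aeval_eq hθ hi
    obtain ⟨q, hq⟩ := h.corner_aeval_mem_range hμ1 hμX f
    refine ⟨q * p, ?_⟩
    rw [hμm, hq, hf, mul_assoc, es_zero_mul_mu hμ1 hμm]
  | succ r =>
    rw [chainSpan] at hx
    suffices (⨆ u : Fin (r + 1), ⨆ i : Fin (d + 1), (chainSpan F d e es (LinearMap.range μ) u).map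
        (LinearMap.mulLeft F (es (r + 1) * e i))) ≤
        (chainSpan F d e es (LinearMap.range μ) s).comap (LinearMap.mulLeft F (es s * e i)) from
      this hx
    refine iSup_le fun u => iSup_le fun j => ?_
    rintro _ ⟨y, hy, rfl⟩
    have hu := u.2
    have hy' := h.es_mul_chainSpan hμ1 hμm (by omega) hy
    have := h.mem_of_forall_lt_mem hθ hθs hs (show (u : ℕ) ≤ d by omega)
      (show s + u < 2 * (r + 1) by omega)
      ((chainSpan F d e es (LinearMap.range μ) s).comap (LinearMap.mulRight F y))
      (by
        intro v hv i' j' hi' hj'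
        have h1 := ih v hv (by omega) s i' hs hi' _
          (ih u hu (by omega) v j' (by omega) hj' y hy)
        simpa only [Submodule.mem_comap, LinearMap.mulRight_apply, mul_assoc, hy'] using h1)
      (d - (r + 1)) (r + 1) (by omega) i j hi (by omega)
    simpa only [Submodule.mem_comap, LinearMap.mulRight_apply, LinearMap.mulLeft_apply, mul_assoc,
      hy'] using this

include h hθ hθs hμ1 hμm hμX in
/-- If `R` is generated by the `e i` and `es i`, then `e*_r R e*_0` is contained in the span of
the decreasing chains starting at `r`. -/
theorem es_mul_mul_es_zero_mem_chainSpan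
    (hgen : Algebra.adjoin F (e '' Set.Iic d ∪ es '' Set.Iic d) = ⊤) (t : R) {r : ℕ} (hr : r ≤ d) :
    es r * t * es 0 ∈ chainSpan F d e es (LinearMap.range μ) r := by
  suffices hmain : ∀ r ≤ d, ∀ x ∈ chainSpan F d e es (LinearMap.range μ) r, ∀ s ≤ d,
      es s * (t * x) ∈ chainSpan F d e es (LinearMap.range μ) s by
    rw [mul_assoc]
    refine hmain 0 (Nat.zero_le d) _ ?_ r hr
    rw [chainSpan]
    exact ⟨1, hμ1⟩
  have ht : t ∈ Algebra.adjoin F (e '' Set.Iic d ∪ es '' Set.Iic d) := hgen ▸ Algebra.mem_top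
  have hes : ∀ r ≤ d, ∀ x ∈ chainSpan F d e es (LinearMap.range μ) r, ∀ s ≤ d,
      es s * x ∈ chainSpan F d e es (LinearMap.range μ) s := by
    intro r hr x hx s hs
    rw [← h.es_mul_chainSpan hμ1 hμm hr hx, ← mul_assoc, h.es_mul s r hs hr]
    split_ifs with hsr
    · subst hsr
      rwa [h.es_mul_chainSpan hμ1 hμm hr hx]
    · simp
  induction ht using Algebra.adjoin_induction with
  | mem t ht =>
    intro r hr x hx s hs
    rcases ht with ⟨i, hi, rfl⟩ | ⟨i, hi, rfl⟩
    · rw [← mul_assoc]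
      exact h.mul_mem_chainSpan hθ hθs hμ1 hμm hμX hr s i hs hi x hx
    · rw [← mul_assoc, h.es_mul s i hs hi]
      split_ifs
      · exact hes r hr x hx s hs
      · simp
  | algebraMap c =>
    intro r hr x hx s hs
    rw [← Algebra.smul_def, mul_smul_comm]
    exact Submodule.smul_mem _ _ (hes r hr x hx s hs)
  | add t t' _ _ ht ht' =>
    intro r hr x hx s hs
    rw [add_mul, mul_add]
    exact Submodule.add_mem _ (ht r hr x hx s hs) (ht' r hr x hx s hs)
  | mul t t' _ _ ht ht' =>
    intro r hr x hx s hs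
    have : t' * x = ∑ k ∈ Finset.range (d + 1), es k * (t' * x) := by
      rw [← Finset.sum_mul, h.sum_es, one_mul]
    rw [mul_assoc, this, Finset.mul_sum, Finset.mul_sum]
    refine Submodule.sum_mem _ fun k hk => ?_
    have hk : k ≤ d := by simpa [Nat.lt_succ_iff] using hk
    exact ht k hk _ (ht' r hr x hx k hk) s hs

end

end TDRel

end Corner

section TAlgFacts

variable (F : Type*) [Field F] (d : ℕ) (θ θs : ℕ → F)

theorem eT_of_le {i : ℕ} (hi : i ≤ d) :
    eT F d θ θs i = tgen F d θ θs (TGen.e ⟨i, Nat.lt_succ_of_le hi⟩) :=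
  dif_pos _

theorem esT_of_le {i : ℕ} (hi : i ≤ d) :
    esT F d θ θs i = tgen F d θ θs (TGen.estar ⟨i, Nat.lt_succ_of_le hi⟩) :=
  dif_pos _

theorem aT_eq_specOp : aT F d θ θs = specOp d θ (eT F d θ θs) := by
  have h := RingQuot.mkAlgHom_rel F (TRel.a_eq (F := F) (d := d) (θ := θ) (θs := θs))
  rw [map_sum] at h
  rw [aT, tgen, h, specOp, Finset.sum_range]
  refine Finset.sum_congr rfl fun i _ => ?_
  rw [eT_of_le F d θ θs (Nat.le_of_lt_succ i.2), map_smul, tgen]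

theorem asT_eq_specOp : asT F d θ θs = specOp d θs (esT F d θ θs) := by
  have h := RingQuot.mkAlgHom_rel F (TRel.astar_eq (F := F) (d := d) (θ := θ) (θs := θs))
  rw [map_sum] at h
  rw [asT, tgen, h, specOp, Finset.sum_range]
  refine Finset.sum_congr rfl fun i _ => ?_
  rw [esT_of_le F d θ θs (Nat.le_of_lt_succ i.2), map_smul, tgen]

theorem tdRel_TAlg : TDRel d θ θs (eT F d θ θs) (esT F d θ θs) := by
  refine ⟨?_, ?_, ?_, ?_, ?_, ?_⟩
  · intro i j hi hj
    have h := RingQuot.mkAlgHom_rel F (TRel.ee (F := F) (d := d) (θ := θ) (θs := θs)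
      ⟨i, Nat.lt_succ_of_le hi⟩ ⟨j, Nat.lt_succ_of_le hj⟩)
    rw [eT_of_le F d θ θs hi, eT_of_le F d θ θs hj, tgen, tgen, ← map_mul, h]
    simp only [Fin.mk.injEq]
    split_ifs <;> simp
  · intro i j hi hj
    have h := RingQuot.mkAlgHom_rel F (TRel.eses (F := F) (d := d) (θ := θ) (θs := θs)
      ⟨i, Nat.lt_succ_of_le hi⟩ ⟨j, Nat.lt_succ_of_le hj⟩)
    rw [esT_of_le F d θ θs hi, esT_of_le F d θ θs hj, tgen, tgen, ← map_mul, h]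
    simp only [Fin.mk.injEq]
    split_ifs <;> simp
  · have h := RingQuot.mkAlgHom_rel F (TRel.sum_e (F := F) (d := d) (θ := θ) (θs := θs))
    rw [map_sum, map_one] at h
    rw [← h, Finset.sum_range]
    exact Finset.sum_congr rfl fun i _ => eT_of_le F d θ θs (Nat.le_of_lt_succ i.2)
  · have h := RingQuot.mkAlgHom_rel F (TRel.sum_estar (F := F) (d := d) (θ := θ) (θs := θs))
    rw [map_sum, map_one] at h
    rw [← h, Finset.sum_range]
    exact Finset.sum_congr rfl fun i _ => esT_of_le F d θ θs (Nat.le_of_lt_succ i.2)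
  · intro i j hi hj k hk
    have h := RingQuot.mkAlgHom_rel F (TRel.trid (F := F) (d := d) (θ := θ) (θs := θs)
      ⟨i, Nat.lt_succ_of_le hi⟩ ⟨j, Nat.lt_succ_of_le hj⟩ k (by omega) hk)
    rw [map_mul, map_mul, map_pow, map_zero] at h
    rw [← aT_eq_specOp, esT_of_le F d θ θs hi, esT_of_le F d θ θs hj]
    exact h
  · intro i j hi hj k hk
    have h := RingQuot.mkAlgHom_rel F (TRel.tridstar (F := F) (d := d) (θ := θ) (θs := θs)
      ⟨i, Nat.lt_succ_of_le hi⟩ ⟨j, Nat.lt_succ_of_le hj⟩ k (by omega) hk)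
    rw [map_mul, map_mul, map_pow, map_zero] at h
    rw [← asT_eq_specOp, eT_of_le F d θ θs hi, eT_of_le F d θ θs hj]
    exact h

theorem specOp_mem_adjoin {R : Type*} [Ring R] [Algebra F R] (η : ℕ → F) (x : ℕ → R) (S : Set R)
    (hS : ∀ i ≤ d, x i ∈ S) : specOp d η x ∈ Algebra.adjoin F S := by
  refine Subalgebra.sum_mem _ fun i hi => Subalgebra.smul_mem _ (Algebra.subset_adjoin (hS i ?_)) _
  simpa [Nat.lt_succ_iff] using hi

theorem adjoin_idempotents_TAlg :
    Algebra.adjoin F (eT F d θ θs '' Set.Iic d ∪ esT F d θ θs '' Set.Iic d) = ⊤ := by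
  set S := Algebra.adjoin F (eT F d θ θs '' Set.Iic d ∪ esT F d θ θs '' Set.Iic d)
  rw [eq_top_iff]
  rintro t -
  obtain ⟨x, rfl⟩ := RingQuot.mkAlgHom_surjective F (TRel F d θ θs) t
  induction x with
  | grade0 r => rw [AlgHom.commutes]; exact S.algebraMap_mem r
  | add x y hx hy => rw [map_add]; exact S.add_mem hx hy
  | mul x y hx hy => rw [map_mul]; exact S.mul_mem hx hy
  | grade1 g =>
    cases g with
    | a =>
      change aT F d θ θs ∈ S
      rw [aT_eq_specOp]
      exact specOp_mem_adjoin F d θ _ _ fun i hi => Or.inl ⟨i, hi, rfl⟩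
    | astar =>
      change asT F d θ θs ∈ S
      rw [asT_eq_specOp]
      exact specOp_mem_adjoin F d θs _ _ fun i hi => Or.inr ⟨i, hi, rfl⟩
    | e i =>
      exact Algebra.subset_adjoin
        (Or.inl ⟨i, Nat.le_of_lt_succ i.2, eT_of_le F d θ θs (Nat.le_of_lt_succ i.2)⟩)
    | estar i =>
      exact Algebra.subset_adjoin
        (Or.inr ⟨i, Nat.le_of_lt_succ i.2, esT_of_le F d θ θs (Nat.le_of_lt_succ i.2)⟩)

variable {F d θ θs}

theorem TDRel.exists_algHom {R : Type*} [Ring R] [Algebra F R] {e es : ℕ → R}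
    (h : TDRel d θ θs e es) : ∃ ρ : TAlg F d θ θs →ₐ[F] R,
      (∀ i ≤ d, ρ (eT F d θ θs i) = e i) ∧ (∀ i ≤ d, ρ (esT F d θ θs i) = es i) := by
  let gen : TGen d → R
    | TGen.a => specOp d θ e
    | TGen.astar => specOp d θs es
    | TGen.e i => e i
    | TGen.estar i => es i
  have hrel : ∀ ⦃x y : FreeAlgebra F (TGen d)⦄, TRel F d θ θs x y →
      FreeAlgebra.lift F gen x = FreeAlgebra.lift F gen y := by
    intro x y hxy
    cases hxy with
    | ee i j =>
      rw [map_mul, FreeAlgebra.lift_ι_apply, FreeAlgebra.lift_ι_apply]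
      refine (h.e_mul i j (Nat.le_of_lt_succ i.2) (Nat.le_of_lt_succ j.2)).trans ?_
      simp only [← Fin.ext_iff]
      split_ifs <;> simp [gen]
    | eses i j =>
      rw [map_mul, FreeAlgebra.lift_ι_apply, FreeAlgebra.lift_ι_apply]
      refine (h.es_mul i j (Nat.le_of_lt_succ i.2) (Nat.le_of_lt_succ j.2)).trans ?_
      simp only [← Fin.ext_iff]
      split_ifs <;> simp [gen]
    | sum_e => simp [gen, ← h.sum_e, Finset.sum_range]
    | sum_estar => simp [gen, ← h.sum_es, Finset.sum_range]
    | a_eq => simp [gen, specOp, Finset.sum_range]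
    | astar_eq => simp [gen, specOp, Finset.sum_range]
    | trid i j k hk hlt =>
      simpa [gen] using h.es_pow i j (Nat.le_of_lt_succ i.2) (Nat.le_of_lt_succ j.2) k hlt
    | tridstar i j k hk hlt =>
      simpa [gen] using h.e_pow i j (Nat.le_of_lt_succ i.2) (Nat.le_of_lt_succ j.2) k hlt
  refine ⟨RingQuot.liftAlgHom F ⟨FreeAlgebra.lift F gen, hrel⟩, ?_, ?_⟩
  · intro i hi
    rw [eT_of_le F d θ θs hi, tgen, RingQuot.liftAlgHom_mkAlgHom_apply, FreeAlgebra.lift_ι_apply]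
  · intro i hi
    rw [esT_of_le F d θ θs hi, tgen, RingQuot.liftAlgHom_mkAlgHom_apply, FreeAlgebra.lift_ι_apply]

theorem es_mul_mul_es_zero_mem_range_of_muProps
    {μ : MvPolynomial (Fin d) F →ₗ[F] TAlg F d θ θs} (hμ : MuProps F d θ θs μ)
    (t : TAlg F d θ θs) : esT F d θ θs 0 * t * esT F d θ θs 0 ∈ LinearMap.range μ := by
  rw [hμ.2.2.2]
  exact ⟨t, by simp [mul_assoc]⟩

theorem exists_muProps (hθ : ∀ i j, i ≤ d → j ≤ d → i ≠ j → θ i ≠ θ j)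
    (hθs : ∀ i j, i ≤ d → j ≤ d → i ≠ j → θs i ≠ θs j) :
    ∃ μ : MvPolynomial (Fin d) F →ₗ[F] TAlg F d θ θs, MuProps F d θ θs μ := by
  have h := tdRel_TAlg F d θ θs
  obtain ⟨μ, hμ1, hμm, hμX⟩ := h.exists_mu hθ hθs
  refine ⟨μ, hμ1, hμm, fun i => by rw [hμX, aT_eq_specOp], le_antisymm ?_ ?_⟩
  · rintro _ ⟨p, rfl⟩
    refine ⟨μ p, ?_⟩
    simp [TDRel.mu_mul_es_zero hμ1 hμm, TDRel.es_zero_mul_mu hμ1 hμm]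
  · rintro _ ⟨t, rfl⟩
    have := h.es_mul_mul_es_zero_mem_chainSpan hθ hθs hμ1 hμm hμX
      (adjoin_idempotents_TAlg F d θ θs) t (Nat.zero_le d)
    rw [chainSpan] at this
    simpa [mul_assoc] using this

end TAlgFacts

section TDOperators

variable {F : Type*} [Field F] {R : Type*} [Ring R] [Algebra F R] {d : ℕ} {θ θs : ℕ → F}
  {e es : ℕ → R}

theorem mul_pow_mul_eq_zero_of_adjacent (a : R)
    (hmul : ∀ i j, i ≤ d → j ≤ d → es i * es j = if i = j then es i else 0)
    (hsum : ∑ i ∈ Finset.range (d + 1), es i = 1)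
    (hadj : ∀ i j, i ≤ d → j ≤ d → 1 < max (i - j) (j - i) → es i * a * es j = 0)
    (k : ℕ) : ∀ i j, i ≤ d → j ≤ d → k < max (i - j) (j - i) → es i * a ^ k * es j = 0 := by
  induction k with
  | zero =>
    intro i j hi hj hk
    rw [pow_zero, mul_one, hmul i j hi hj, if_neg (by omega)]
  | succ k ih =>
    intro i j hi hj hk
    have : es i * a ^ (k + 1) * es j =
        ∑ m ∈ Finset.range (d + 1), (es i * a ^ k * es m) * (es m * a * es j) := by
      have h1 : ∀ m ∈ Finset.range (d + 1), (es i * a ^ k * es m) * (es m * a * es j) =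
          es i * a ^ k * es m * (a * es j) := by
        intro m hm
        have hm : m ≤ d := by simpa [Nat.lt_succ_iff] using hm
        have := hmul m m hm hm
        rw [if_pos rfl] at this
        rw [← mul_assoc, ← mul_assoc, mul_assoc _ (es m) (es m), this, mul_assoc _ a]
      rw [Finset.sum_congr rfl h1, ← Finset.sum_mul, ← Finset.mul_sum, hsum, mul_one, pow_succ]
      simp only [mul_assoc]
    rw [this]
    refine Finset.sum_eq_zero fun m hm => ?_
    have hm : m ≤ d := by simpa [Nat.lt_succ_iff] using hm
    by_cases hmj : 1 < max (m - j) (j - m)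
    · rw [hadj m j hm hj hmj, mul_zero]
    · rw [ih i m hi hm (by omega), zero_mul]

theorem specOp_reflect (η : ℕ → F) (x : ℕ → R) :
    specOp d (fun i => η (d - i)) (fun i => x (d - i)) = specOp d η x := by
  have := Finset.sum_range_reflect (fun i => η i • x i) (d + 1)
  simpa [specOp] using this

namespace TDRel

theorem reflect (h : TDRel d θ θs e es) :
    TDRel d (fun i => θ (d - i)) θs (fun i => e (d - i)) es := by
  refine ⟨?_, h.es_mul, ?_, h.sum_es, ?_, ?_⟩
  · intro i j hi hj
    rw [h.e_mul _ _ (Nat.sub_le _ _) (Nat.sub_le _ _)]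
    have : d - i = d - j ↔ i = j := by omega
    simp only [this]
  · have := Finset.sum_range_reflect e (d + 1)
    simpa [h.sum_e] using this
  · intro i j hi hj k hk
    rw [specOp_reflect]
    exact h.es_pow i j hi hj k hk
  · intro i j hi hj k hk
    exact h.e_pow _ _ (Nat.sub_le _ _) (Nat.sub_le _ _) k (by omega)

theorem es_pow_mul_mul_pow (h : TDRel d θ θs e es) {i j m n : ℕ} (hi : i ≤ d) (hj : j ≤ d)
    (hij : j + n + m ≤ i) (c : ℕ → F) :
    es i * specOp d θ e ^ m * specOp d c es * specOp d θ e ^ n * es j =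
      c (j + n) • (es i * specOp d θ e ^ (m + n) * es j) := by
  have key : ∀ c : ℕ → F,
      es i * specOp d θ e ^ m * specOp d c es * specOp d θ e ^ n * es j =
      c (j + n) • (es i * specOp d θ e ^ m * es (j + n) * specOp d θ e ^ n * es j) := by
    intro c
    rw [specOp.eq_def d c, Finset.mul_sum, Finset.sum_mul, Finset.sum_mul,
      Finset.sum_eq_single (j + n)]
    · simp
    · intro k hk hkn
      have hk : k ≤ d := by simpa [Nat.lt_succ_iff] using hk
      simp only [mul_smul_comm, smul_mul_assoc]
      rcases lt_or_gt_of_ne hkn with hlt | hgt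
      · rw [h.es_pow i k hi hk m (by omega)]; simp
      · rw [mul_assoc, mul_assoc, ← mul_assoc (es k), h.es_pow k j hk hj n (by omega)]; simp
    · intro hk; simp at hk; omega
  have hone := key fun _ => 1
  have h1 : specOp d (fun _ => (1 : F)) es = 1 := by simp [specOp, h.sum_es]
  rw [h1, mul_one, one_smul, mul_assoc (es i), ← pow_add] at hone
  rw [key, hone]

theorem es_aeval_es_of_natDegree_le (h : TDRel d θ θs e es) {j n : ℕ} (hj : j + n ≤ d) (f : F[X])
    (hf : f.natDegree ≤ n) : es (j + n) * aeval (specOp d θ e) f * es j =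
      f.coeff n • (es (j + n) * specOp d θ e ^ n * es j) := by
  rw [Polynomial.aeval_eq_sum_range' (Nat.lt_succ_of_le hf), Finset.mul_sum, Finset.sum_mul,
    Finset.sum_eq_single n]
  · simp
  · intro k hk hkn
    have hk : k ≤ n := by simpa [Nat.lt_succ_iff] using hk
    rw [mul_smul_comm, smul_mul_assoc, h.es_pow _ _ hj (by omega) k (by omega), smul_zero]
  · intro hk; simp at hk

theorem eval_tauPoly_eq_zero {i j : ℕ} (hij : j < i) : (tauPoly θ i).eval (θ j) = 0 := by
  rw [tauPoly, eval_prod, Finset.prod_eq_zero (Finset.mem_range.mpr hij) (by simp)]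

theorem eval_tauPoly_ne_zero (hθ : ∀ i j, i ≤ d → j ≤ d → i ≠ j → θ i ≠ θ j) :
    (tauPoly θ d).eval (θ d) ≠ 0 := by
  rw [tauPoly, Finset.range_eq_Ico]
  exact eval_prod_X_sub_C_ne_zero hθ le_rfl

theorem aeval_tauPoly (h : TDRel d θ θs e es) :
    aeval (specOp d θ e) (tauPoly θ d) = (tauPoly θ d).eval (θ d) • e d := by
  rw [h.aeval_eq_sum, Finset.sum_range_succ, Finset.sum_eq_zero, zero_add]
  intro i hi
  rw [eval_tauPoly_eq_zero (Finset.mem_range.mp hi), zero_smul]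

theorem es_pow_es_ne_zero (h : TDRel d θ θs e es)
    (hθ : ∀ i j, i ≤ d → j ≤ d → i ≠ j → θ i ≠ θ j) (hne : es d * e d * es 0 ≠ 0)
    {j n : ℕ} (hj : j + n ≤ d) : es (j + n) * specOp d θ e ^ n * es j ≠ 0 := by
  intro h0
  have h1 : (specOp d (fun i => if i = j then (1 : F) else 0) es) = es j := by
    rw [specOp, Finset.sum_eq_single j]
    · simp
    · intro i _ hij; simp [hij]
    · intro hk; simp at hk; omega
  have h2 : (specOp d (fun i => if i = j + n then (1 : F) else 0) es) = es (j + n) := by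
    rw [specOp, Finset.sum_eq_single (j + n)]
    · simp
    · intro i _ hij; simp [hij]
    · intro hk; simp at hk; omega
  have h3 : es (j + n) * specOp d θ e ^ (n + j) * es 0 = 0 := by
    have := h.es_pow_mul_mul_pow (i := j + n) (j := 0) (m := n) (n := j) hj (Nat.zero_le d)
      (by omega) (fun i => if i = j then (1 : F) else 0)
    rw [h1, h0] at this
    simpa using this.symm
  have h4 : es d * specOp d θ e ^ d * es 0 = 0 := by
    have := h.es_pow_mul_mul_pow (i := d) (j := 0) (m := d - (j + n)) (n := n + j) le_rfl
      (Nat.zero_le d) (by omega) (fun i => if i = j + n then (1 : F) else 0)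
    rw [h2, mul_assoc, mul_assoc, ← mul_assoc (es (j + n)), h3, mul_zero,
      show d - (j + n) + (n + j) = d by omega, if_pos (by omega), one_smul] at this
    exact this.symm
  have h5 := h.es_aeval_es_of_natDegree_le (j := 0) (n := d) (by omega) (tauPoly θ d) (by
    rw [tauPoly, Polynomial.natDegree_finsetProd_X_sub_C_eq_card, Finset.card_range])
  rw [zero_add, h4, smul_zero, h.aeval_tauPoly, mul_smul_comm, smul_mul_assoc] at h5
  exact hne ((smul_eq_zero.mp h5).resolve_left (eval_tauPoly_ne_zero hθ))

end TDRel

end TDOperators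

section Idempotents

variable {F : Type*} [Field F] {R : Type*} [Ring R] [Algebra F R] {d : ℕ} {θ θs : ℕ → F}
  {e es : ℕ → R}

theorem specOp_ite {j : ℕ} (hj : j ≤ d) (x : ℕ → R) :
    specOp d (fun i => if i = j then (1 : F) else 0) x = x j := by
  rw [specOp, Finset.sum_eq_single j]
  · simp
  · intro i _ hij; simp [hij]
  · intro hk; simp at hk; omega

namespace TDRel

theorem e_ne_zero (h : TDRel d θ θs e es)
    (hθs : ∀ i j, i ≤ d → j ≤ d → i ≠ j → θs i ≠ θs j) (hne : e d * es 0 * e 0 ≠ 0)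
    {j : ℕ} (hj : j ≤ d) : e j ≠ 0 := by
  intro h0
  have h1 := h.swap.es_pow_mul_mul_pow (i := d) (j := 0) (m := d - j) (n := j) le_rfl
    (Nat.zero_le d) (by omega) (fun i => if i = j then (1 : F) else 0)
  rw [specOp_ite hj, h0, show d - j + j = d by omega, if_pos (by omega), one_smul] at h1
  set q : F[X] := ∏ k ∈ Finset.Ico 1 (d + 1), (X - C (θs k)) with hq
  have h2 := h.swap.es_aeval_es_of_natDegree_le (j := 0) (n := d) (by omega) q (by
    rw [hq, Polynomial.natDegree_finsetProd_X_sub_C_eq_card]; simp)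
  rw [zero_add, ← h1] at h2
  have h3 : aeval (specOp d θs es) q = q.eval (θs 0) • es 0 := by
    rw [h.swap.aeval_eq_sum, Finset.sum_eq_single 0]
    · intro k hk hk0
      rw [hq, eval_prod_X_sub_C_eq_zero (by omega) (by simpa using hk), zero_smul]
    · simp
  have h4 : q.eval (θs 0) ≠ 0 := by
    rw [hq, eval_prod, Finset.prod_ne_zero_iff]
    intro k hk
    have := Finset.mem_Ico.mp hk
    simpa [sub_eq_zero] using hθs 0 k (Nat.zero_le d) (by omega) (by omega)
  rw [h3, mul_smul_comm, smul_mul_assoc] at h2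
  simp only [mul_zero, zero_mul, smul_zero] at h2
  exact hne ((smul_eq_zero.mp h2).resolve_left h4)

theorem es_ne_zero (h : TDRel d θ θs e es)
    (hθs : ∀ i j, i ≤ d → j ≤ d → i ≠ j → θs i ≠ θs j) (hne : e d * es 0 * e 0 ≠ 0)
    {j : ℕ} (hj : j ≤ d) : es j ≠ 0 := by
  intro h0
  rcases Nat.eq_zero_or_pos j with rfl | hj0
  · exact hne (by rw [h0, mul_zero, zero_mul])
  set S := (Finset.Ico 1 (d + 1)).erase j with hS
  set q : F[X] := ∏ k ∈ S, (X - C (θs k)) with hq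
  have h2 := h.swap.es_aeval_es (i := d) (j := 0) le_rfl (Nat.zero_le d) q (by
    rw [hq, Polynomial.natDegree_finsetProd_X_sub_C_eq_card, hS,
      Finset.card_erase_of_mem (by simp; omega)]
    simp; omega)
  have h3 : aeval (specOp d θs es) q = q.eval (θs 0) • es 0 := by
    rw [h.swap.aeval_eq_sum, Finset.sum_eq_single 0]
    · intro k hk hk0
      by_cases hkj : k = j
      · rw [hkj, h0, smul_zero]
      · have : k ∈ S := by simp at hk; simp [hS, hkj]; omega
        rw [hq, eval_prod, Finset.prod_eq_zero this (by simp), zero_smul]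
    · simp
  have h4 : q.eval (θs 0) ≠ 0 := by
    rw [hq, eval_prod, Finset.prod_ne_zero_iff]
    intro k hk
    have := Finset.mem_Ico.mp (Finset.mem_of_mem_erase hk)
    simpa [sub_eq_zero] using hθs 0 k (Nat.zero_le d) (by omega) (by omega)
  rw [h3, mul_smul_comm, smul_mul_assoc] at h2
  exact hne ((smul_eq_zero.mp h2).resolve_left h4)

end TDRel

end Idempotents

section Irreducible

variable {F : Type*} [Field F] {V : Type*} [AddCommGroup V] [Module F V] {d : ℕ}
  {θ θs : ℕ → F} {E Es : ℕ → Module.End F V}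

namespace TDRel

theorem apply_eq_zero (h : TDRel d θ θs E Es) (X : Module.End F V) (w : V)
    (hX : ∀ k ≤ d, X (E k w) = 0) : X w = 0 := by
  have : w = ∑ k ∈ Finset.range (d + 1), E k w := by
    rw [← LinearMap.sum_apply, h.sum_e, Module.End.one_apply]
  rw [this, map_sum]
  exact Finset.sum_eq_zero fun k hk => hX k (by simpa [Nat.lt_succ_iff] using hk)

theorem specOp_sub_apply_eq_zero (h : TDRel d θ θs E Es) {w : V} {i j : ℕ} (hj : j ≤ d)
    (hw : ∀ k ≤ d, i < k → Es k w = 0) (hij : i + 1 < j) (c : F) :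
    Es j (specOp d θ E w - c • w) = 0 := by
  rw [map_sub, map_smul, hw j hj (by omega), smul_zero, sub_zero]
  refine h.swap.apply_eq_zero (Es j * specOp d θ E) w fun k hk => ?_
  by_cases hki : i < k
  · rw [hw k hk hki, map_zero]
  · have := h.es_pow j k hj hk 1 (by omega)
    rw [pow_one] at this
    exact LinearMap.congr_fun this w

theorem specOp_sub_apply (h : TDRel d θ θs E Es) {w : V} {j : ℕ} (hj : j ≤ d) (c : F) :
    E j (specOp d θ E w - c • w) = (θ j - c) • E j w := by
  have := LinearMap.congr_fun (h.mul_specOp hj) w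
  rw [Module.End.mul_apply] at this
  rw [map_sub, this, map_smul, sub_smul]; rfl

/-- In an irreducible module, `E_0` is injective on the range of `E*_0`. -/
theorem eq_zero_of_apply_eq_zero (h : TDRel d θ θs E Es)
    (hirr : ∀ W : Submodule F V, (∀ w ∈ W, specOp d θ E w ∈ W) →
      (∀ w ∈ W, specOp d θs Es w ∈ W) → W = ⊥ ∨ W = ⊤) (h0 : E 0 ≠ 0)
    {v : V} (hv : Es 0 v = v) (hv0 : E 0 v = 0) : v = 0 := by
  let N : ℕ → Submodule F V := fun i =>
    { carrier := {w | (∀ j ≤ d, i < j → Es j w = 0) ∧ ∀ j ≤ d, j ≤ i → E j w = 0}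
      add_mem' := fun {x y} hx hy => ⟨fun j hj hij => by rw [map_add, hx.1 j hj hij,
        hy.1 j hj hij, add_zero], fun j hj hij => by rw [map_add, hx.2 j hj hij, hy.2 j hj hij,
        add_zero]⟩
      zero_mem' := ⟨fun _ _ _ => map_zero _, fun _ _ _ => map_zero _⟩
      smul_mem' := fun c x hx => ⟨fun j hj hij => by rw [map_smul, hx.1 j hj hij, smul_zero],
        fun j hj hij => by rw [map_smul, hx.2 j hj hij, smul_zero]⟩ }
  have hker : (⨆ i, N i) ≤ LinearMap.ker (E 0) :=
    iSup_le fun i w hw => hw.2 0 (Nat.zero_le d) (Nat.zero_le i)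
  have hinv : ∀ B : Module.End F V, (∀ i, ∀ w ∈ N i, B w ∈ ⨆ i, N i) →
      ∀ w ∈ ⨆ i, N i, B w ∈ ⨆ i, N i := fun B hB =>
    show (⨆ i, N i) ≤ (⨆ i, N i).comap B from iSup_le hB
  suffices hmem : (∀ i, ∀ w ∈ N i, specOp d θ E w ∈ ⨆ i, N i) ∧
      ∀ i, ∀ w ∈ N i, specOp d θs Es w ∈ ⨆ i, N i by
    rcases hirr (⨆ i, N i) (hinv _ hmem.1) (hinv _ hmem.2) with hbot | htop
    · have : v ∈ ⨆ i, N i := Submodule.mem_iSup_of_mem 0 ⟨fun j hj hij => ?_, fun j _ hj0 => ?_⟩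
      · simpa [hbot] using this
      · have := h.es_mul j 0 hj (Nat.zero_le d)
        rw [if_neg (by omega)] at this
        rw [← hv]
        exact LinearMap.congr_fun this v
      · rwa [Nat.le_zero.mp hj0]
    · refine absurd (LinearMap.ext fun w => ?_) h0
      exact hker (htop ▸ Submodule.mem_top)
  constructor
  · intro i w hw
    have hmem : specOp d θ E w - θ (i + 1) • w ∈ N (i + 1) := by
      refine ⟨fun j hj hij => h.specOp_sub_apply_eq_zero hj hw.1 hij _, fun j hj hij => ?_⟩
      rw [h.specOp_sub_apply hj]
      rcases Nat.lt_or_eq_of_le hij with hlt | rfl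
      · rw [hw.2 j hj (by omega), smul_zero]
      · rw [sub_self, zero_smul]
    have := Submodule.add_mem (⨆ i, N i) (Submodule.mem_iSup_of_mem _ hmem)
      (Submodule.smul_mem _ (θ (i + 1)) (Submodule.mem_iSup_of_mem i hw))
    rwa [sub_add_cancel] at this
  · intro i w hw
    have hmem : specOp d θs Es w - θs i • w ∈ ⨆ i, N i := by
      have hd : ∀ j ≤ d, i ≤ j → Es j (specOp d θs Es w - θs i • w) = 0 := by
        intro j hj hij
        rw [h.swap.specOp_sub_apply hj]
        rcases Nat.lt_or_eq_of_le hij with hlt | rfl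
        · rw [hw.1 j hj hlt, smul_zero]
        · rw [sub_self, zero_smul]
      rcases i with - | i
      · have : specOp d θs Es w - θs 0 • w = 0 :=
          h.swap.apply_eq_zero 1 _ fun k hk => hd k hk (Nat.zero_le k)
        rw [this]
        exact Submodule.zero_mem _
      · refine Submodule.mem_iSup_of_mem i ⟨fun j hj hij => hd j hj hij, fun j hj hij => ?_⟩
        have hjw : E j w = 0 := hw.2 j hj (by omega)
        rw [map_sub, map_smul, hjw, smul_zero, sub_zero]
        refine h.apply_eq_zero (E j * specOp d θs Es) w fun k hk => ?_
        by_cases hki : k ≤ i + 1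
        · rw [hw.2 k hk hki, map_zero]
        · have := h.e_pow j k hj hk 1 (by omega)
          rw [pow_one] at this
          exact LinearMap.congr_fun this w
    have := Submodule.add_mem (⨆ i, N i) hmem
      (Submodule.smul_mem _ (θs i) (Submodule.mem_iSup_of_mem i hw))
    rwa [sub_add_cancel] at this

/-- In an irreducible module, `E_i` is injective on the range of `E*_j` for `i, j` extreme. -/
theorem mul_ne_zero_of_irreducible (h : TDRel d θ θs E Es)
    (hirr : ∀ W : Submodule F V, (∀ w ∈ W, specOp d θ E w ∈ W) →
      (∀ w ∈ W, specOp d θs Es w ∈ W) → W = ⊥ ∨ W = ⊤)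
    (h0 : E 0 ≠ 0) {X : Module.End F V} (hX : Es 0 * X ≠ 0) : E 0 * (Es 0 * X) ≠ 0 := by
  intro h1
  refine hX (LinearMap.ext fun v => ?_)
  refine h.eq_zero_of_apply_eq_zero hirr h0 (v := Es 0 (X v)) ?_ ?_
  · have := h.es_mul 0 0 (Nat.zero_le d) (Nat.zero_le d)
    rw [if_pos rfl] at this
    exact LinearMap.congr_fun this (X v)
  · exact LinearMap.congr_fun h1 v

theorem triple_ne_zero (h : TDRel d θ θs E Es)
    (hirr : ∀ W : Submodule F V, (∀ w ∈ W, specOp d θ E w ∈ W) →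
      (∀ w ∈ W, specOp d θs Es w ∈ W) → W = ⊥ ∨ W = ⊤)
    (hE : ∀ i ≤ d, E i ≠ 0) (hEs : ∀ i ≤ d, Es i ≠ 0) :
    Es 0 * E 0 * Es 0 ≠ 0 ∧ Es 0 * E d * Es 0 ≠ 0 ∧ Es d * E d * Es 0 ≠ 0 := by
  have h00 : Es 0 * Es 0 = Es 0 := by simpa using h.es_mul 0 0 (Nat.zero_le d) (Nat.zero_le d)
  have hirr' := fun W hA hAs => hirr W hAs hA
  have r0 : ∀ x : ℕ → Module.End F V, ∀ η : ℕ → F,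
      specOp d (fun i => η (d - i)) (fun i => x (d - i)) = specOp d η x := fun x η =>
    specOp_reflect η x
  have hne : Es 0 * Es 0 ≠ 0 := by rw [h00]; exact hEs 0 (Nat.zero_le d)
  have h1 := h.mul_ne_zero_of_irreducible hirr (hE 0 (Nat.zero_le d)) hne
  have h2 := h.reflect.mul_ne_zero_of_irreducible (by rwa [r0])
    (by simpa using hE d le_rfl) hne
  have h3 := h.swap.mul_ne_zero_of_irreducible hirr' (hEs 0 (Nat.zero_le d)) h1
  have h4 := h.reflect.swap.mul_ne_zero_of_irreducible (by rwa [r0]) (hEs 0 (Nat.zero_le d)) h2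
  have h5 := h.reflect.swap.reflect.mul_ne_zero_of_irreducible (by rwa [r0, r0])
    (by simpa using hEs d le_rfl) h2
  simp only [Nat.sub_zero, h00, ← mul_assoc] at h3 h4 h5
  exact ⟨h3, h4, h5⟩

end TDRel

end Irreducible

section EigenvalueRecurrence

variable {F : Type*} [Field F] {R : Type*} [Ring R] [Algebra F R] {d : ℕ} {θ θs : ℕ → F}
  {e es : ℕ → R}

namespace TDRel

theorem eq_of_forall_mul_mul_eq (h : TDRel d θ θs e es) {x y : R}
    (hxy : ∀ i j, i ≤ d → j ≤ d → e i * x * e j = e i * y * e j) : x = y := by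
  have key : ∀ x : R, x =
      ∑ i ∈ Finset.range (d + 1), ∑ j ∈ Finset.range (d + 1), e i * x * e j := by
    intro x
    simp only [← Finset.mul_sum, ← Finset.sum_mul, h.sum_e, mul_one, one_mul]
  rw [key x, key y]
  refine Finset.sum_congr rfl fun i hi => Finset.sum_congr rfl fun j hj => hxy i j ?_ ?_
  · simpa [Nat.lt_succ_iff] using hi
  · simpa [Nat.lt_succ_iff] using hj

theorem exists_commutator_eq (h : TDRel d θ θs e es)
    (hθ : ∀ i j, i ≤ d → j ≤ d → i ≠ j → θ i ≠ θ j) :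
    ∃ g : F[X], g.natDegree ≤ d ∧
      (∀ i, i < d → g.eval (θ i) - g.eval (θ (i + 1)) = θ i * θ (i + 1) * (θ i - θ (i + 1))) ∧
      aeval (specOp d θ e) g * specOp d θs es - specOp d θs es * aeval (specOp d θ e) g =
        specOp d θ e ^ 2 * specOp d θs es * specOp d θ e ^ 1 -
          specOp d θ e ^ 1 * specOp d θs es * specOp d θ e ^ 2 := by
  let z : ℕ → F := fun i => ∑ k ∈ Finset.range i, -(θ k * θ (k + 1) * (θ k - θ (k + 1)))
  have hz : ∀ i, z i - z (i + 1) = θ i * θ (i + 1) * (θ i - θ (i + 1)) := by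
    intro i
    simp only [z, Finset.sum_range_succ]
    ring
  have hinj : Set.InjOn θ (Finset.range (d + 1)) := by
    intro a ha b hb hab
    simp only [Finset.coe_range, Set.mem_Iio] at ha hb
    by_contra hne
    exact hθ a b (by omega) (by omega) hne hab
  set g := Lagrange.interpolate (Finset.range (d + 1)) θ z with hg
  have hgz : ∀ i ≤ d, g.eval (θ i) = z i := fun i hi =>
    Lagrange.eval_interpolate_at_node z hinj (by simpa [Nat.lt_succ_iff] using hi)
  refine ⟨g, ?_, ?_, ?_⟩
  · have := Lagrange.degree_interpolate_lt z hinj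
    rw [Finset.card_range] at this
    rw [degree_lt_iff_coeff_zero] at this
    exact natDegree_le_iff_coeff_eq_zero.mpr fun N hN => this N hN
  · intro i hi
    rw [hgz i (by omega), hgz (i + 1) (by omega), hz]
  · refine h.eq_of_forall_mul_mul_eq fun i j hi hj => ?_
    have hA : ∀ f : F[X], e i * (aeval (specOp d θ e) f * specOp d θs es) * e j =
        f.eval (θ i) • (e i * specOp d θs es * e j) := by
      intro f
      rw [← mul_assoc, h.mul_aeval f hi, smul_mul_assoc, smul_mul_assoc]
    have hB : ∀ f : F[X], e i * (specOp d θs es * aeval (specOp d θ e) f) * e j =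
        f.eval (θ j) • (e i * specOp d θs es * e j) := by
      intro f
      rw [mul_assoc, mul_assoc (specOp d θs es), h.aeval_mul f hj, mul_smul_comm, mul_smul_comm,
        ← mul_assoc]
    have hC : ∀ k l : ℕ, e i * (specOp d θ e ^ k * specOp d θs es * specOp d θ e ^ l) * e j =
        (θ i ^ k * θ j ^ l) • (e i * specOp d θs es * e j) := by
      intro k l
      have h1 := h.mul_aeval (X ^ k) hi
      have h2 := h.aeval_mul (X ^ l) hj
      simp only [map_pow, aeval_X, eval_pow, eval_X] at h1 h2
      rw [mul_assoc (e i), mul_assoc _ (specOp d θ e ^ l), h2, mul_smul_comm, mul_smul_comm,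
        mul_assoc (specOp d θ e ^ k), ← mul_assoc, h1, smul_mul_assoc, smul_smul, mul_comm,
        mul_assoc]
    rw [mul_sub, mul_sub, sub_mul, sub_mul, hA, hB, hC, hC, ← sub_smul, ← sub_smul, hgz i hi,
      hgz j hj]
    by_cases hij : 1 < max (i - j) (j - i)
    · have := h.e_pow i j hi hj 1 hij
      rw [pow_one] at this
      rw [this, smul_zero, smul_zero]
    · congr 1
      obtain rfl | rfl | rfl : i = j ∨ j = i + 1 ∨ i = j + 1 := by omega
      · ring
      · rw [hz]; ring
      · rw [← neg_sub, hz]; ring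

theorem eigCond (h : TDRel d θ θs e es)
    (hθ : ∀ i j, i ≤ d → j ≤ d → i ≠ j → θ i ≠ θ j)
    (hθs : ∀ i j, i ≤ d → j ≤ d → i ≠ j → θs i ≠ θs j) (hne : es d * e d * es 0 ≠ 0) :
    EigCond F d θ θs := by
  refine ⟨hθ, hθs, ?_⟩
  obtain ⟨g, hgd, hgθ, hgc⟩ := h.exists_commutator_eq hθ
  have hrec : ∀ j n, 3 ≤ n → j + n ≤ d → g.natDegree ≤ n →
      ((θs j - θs (j + n)) * g.coeff n) • (es (j + n) * specOp d θ e ^ n * es j) =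
      (θs (j + 1) - θs (j + 2)) • (es (j + n) * specOp d θ e ^ 3 * es j) := by
    intro j n hn hjn hg
    have h1 := congrArg (fun x => es (j + n) * x * es j) hgc
    have h2 := h.es_aeval_es_of_natDegree_le hjn g hg
    have h3 := h.es_pow_mul_mul_pow (m := 2) (n := 1) hjn (by omega : j ≤ d) (by omega) θs
    have h4 := h.es_pow_mul_mul_pow (m := 1) (n := 2) hjn (by omega : j ≤ d) (by omega) θs
    have h5 : es (j + n) * (aeval (specOp d θ e) g * specOp d θs es) * es j =
        θs j • (es (j + n) * aeval (specOp d θ e) g * es j) := by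
      rw [mul_assoc, mul_assoc (aeval _ g), h.swap.specOp_mul (by omega), mul_smul_comm,
        mul_smul_comm, ← mul_assoc]
    have h6 : es (j + n) * (specOp d θs es * aeval (specOp d θ e) g) * es j =
        θs (j + n) • (es (j + n) * aeval (specOp d θ e) g * es j) := by
      rw [← mul_assoc, h.swap.mul_specOp hjn, smul_mul_assoc, smul_mul_assoc]
    simp only [mul_sub, sub_mul, h5, h6] at h1
    simp only [← mul_assoc, h3, h4, h2, ← sub_smul, smul_smul] at h1
    rw [sub_mul]
    exact h1
  have hdeg : g.natDegree ≤ 3 := by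
    by_contra hlt
    have h1 := hrec 0 g.natDegree (by omega) (by omega) le_rfl
    rw [h.es_pow _ 0 (by omega) (Nat.zero_le d) 3 (by omega), smul_zero] at h1
    have h2 := h.es_pow_es_ne_zero hθ hne (j := 0) (n := g.natDegree) (by omega)
    rcases mul_eq_zero.mp ((smul_eq_zero.mp h1).resolve_right h2) with h3 | h3
    · exact hθs 0 (0 + g.natDegree) (by omega) (by omega) (by omega) (sub_eq_zero.mp h3)
    · rw [coeff_natDegree, leadingCoeff_eq_zero] at h3
      rw [h3, natDegree_zero] at hlt
      omega
  set c := g.coeff 3 with hc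
  have hs : ∀ j, j + 3 ≤ d → (θs j - θs (j + 3)) * c = θs (j + 1) - θs (j + 2) := fun j hj =>
    smul_left_injective F (h.es_pow_es_ne_zero hθ hne hj) (hrec j 3 le_rfl hj hdeg)
  have hgeval : ∀ x, g.eval x = c * x ^ 3 + g.coeff 2 * x ^ 2 + g.coeff 1 * x + g.coeff 0 := by
    intro x
    rw [eval_eq_sum_range' (Nat.lt_succ_of_le hdeg)]
    simp only [Finset.sum_range_succ, Finset.sum_range_zero]
    ring
  have hquad : ∀ i, i < d → c * (θ i ^ 2 + θ i * θ (i + 1) + θ (i + 1) ^ 2) +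
      g.coeff 2 * (θ i + θ (i + 1)) + g.coeff 1 = θ i * θ (i + 1) := by
    intro i hi
    have h1 := hgθ i hi
    rw [hgeval, hgeval] at h1
    refine mul_right_cancel₀
      (sub_ne_zero.mpr (hθ i (i + 1) (by omega) (by omega) (by omega))) ?_
    linear_combination h1
  have hlin : ∀ i, i + 2 ≤ d → c * (θ i + θ (i + 1) + θ (i + 2)) + g.coeff 2 = θ (i + 1) := by
    intro i hi
    refine mul_right_cancel₀
      (sub_ne_zero.mpr (hθ i (i + 2) (by omega) (by omega) (by omega))) ?_
    linear_combination hquad i (by omega) - hquad (i + 1) (by omega)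
  have hθc : ∀ i, i + 3 ≤ d → (θ i - θ (i + 3)) * c = θ (i + 1) - θ (i + 2) := by
    intro i hi
    linear_combination hlin i (by omega) - hlin (i + 1) (by omega)
  refine ⟨c⁻¹, fun i hi hid => ?_⟩
  obtain ⟨j, rfl⟩ : ∃ j, i = j + 2 := ⟨i - 2, by omega⟩
  have hc0 : c ≠ 0 := by
    intro h0
    have := hθc j (by omega)
    rw [h0, mul_zero] at this
    exact hθ (j + 1) (j + 2) (by omega) (by omega) (by omega) (sub_eq_zero.mp this.symm)
  simp only [Nat.add_sub_cancel, show j + 2 - 1 = j + 1 by omega]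
  constructor
  · rw [← hθc j (by omega)]; field_simp
  · rw [← hs j (by omega)]; field_simp

end TDRel

end EigenvalueRecurrence

section SplitSequence

variable {F : Type*} [Field F] {R : Type*} [Ring R] [Algebra F R] {d : ℕ} {θ θs ζ : ℕ → F}
  {e es : ℕ → R}

theorem etaPoly_sub_eq_prod_Ico (θ : ℕ → F) {i : ℕ} (hi : i ≤ d) :
    etaPoly d θ (d - i) = ∏ j ∈ Finset.Ico (i + 1) (d + 1), (X - C (θ j)) := by
  rw [etaPoly, ← Finset.prod_range_reflect, Finset.prod_Ico_eq_prod_range,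
    show d + 1 - (i + 1) = d - i by omega]
  refine Finset.prod_congr rfl fun j hj => ?_
  have := Finset.mem_range.mp hj
  rw [show d - (d - i - 1 - j) = i + 1 + j by omega]

theorem prod_X_sub_C_eq_sum_tauPoly (θ : ℕ → F) (n : ℕ) :
    ∏ j ∈ Finset.Ico 1 (n + 1), (X - C (θ j)) = ∑ i ∈ Finset.range (n + 1),
      C ((∏ j ∈ Finset.Ico (i + 1) (n + 1), (X - C (θ j))).eval (θ 0)) * tauPoly θ i := by
  induction n with
  | zero => simp [tauPoly]
  | succ n ih =>
    have h1 : ∏ j ∈ Finset.Ico 1 (n + 1 + 1), (X - C (θ j)) =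
        (∏ j ∈ Finset.Ico 1 (n + 1), (X - C (θ j))) * C (θ 0 - θ (n + 1)) +
          tauPoly θ (n + 1) := by
      rw [Finset.prod_Ico_succ_top (by omega), tauPoly, Finset.range_eq_Ico,
        Finset.prod_eq_prod_Ico_succ_bot (Nat.succ_pos n), C_sub]
      ring
    rw [h1, Finset.sum_range_succ, ih, Finset.sum_mul]
    congr 1
    · refine Finset.sum_congr rfl fun i hi => ?_
      have := Finset.mem_range.mp hi
      rw [Finset.prod_Ico_succ_top (a := i + 1) (b := n + 1) (by omega), eval_mul, C_mul]
      simp only [eval_sub, eval_X, eval_C]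
      ring
    · simp

namespace TDRel

theorem exists_smul_es_e_last_es (h : TDRel d θ θs e es)
    (hθ : ∀ i j, i ≤ d → j ≤ d → i ≠ j → θ i ≠ θ j)
    (hθs : ∀ i j, i ≤ d → j ≤ d → i ≠ j → θs i ≠ θs j)
    (hζ : ∀ i, i ≤ d → es 0 * aeval (specOp d θ e) (tauPoly θ i) * es 0 =
      (ζ i / ∏ h ∈ Finset.Icc 1 i, (θs 0 - θs h)) • es 0) :
    ∃ k : F, k ≠ 0 ∧ k • (es 0 * e d * es 0) = ζ d • es 0 := by
  have hP : ∏ h ∈ Finset.Icc 1 d, (θs 0 - θs h) ≠ 0 := by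
    rw [Finset.prod_ne_zero_iff]
    intro j hj
    have := Finset.mem_Icc.mp hj
    exact sub_ne_zero.mpr (hθs 0 j (by omega) (by omega) (by omega))
  have h1 := hζ d le_rfl
  rw [h.aeval_tauPoly, mul_smul_comm, smul_mul_assoc] at h1
  refine ⟨(∏ h ∈ Finset.Icc 1 d, (θs 0 - θs h)) * (tauPoly θ d).eval (θ d),
    mul_ne_zero hP (eval_tauPoly_ne_zero hθ), ?_⟩
  rw [mul_smul, h1, smul_smul, mul_div_cancel₀ _ hP]

theorem exists_smul_es_e_zero_es (h : TDRel d θ θs e es)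
    (hθ : ∀ i j, i ≤ d → j ≤ d → i ≠ j → θ i ≠ θ j)
    (hθs : ∀ i j, i ≤ d → j ≤ d → i ≠ j → θs i ≠ θs j)
    (hζ : ∀ i, i ≤ d → es 0 * aeval (specOp d θ e) (tauPoly θ i) * es 0 =
      (ζ i / ∏ h ∈ Finset.Icc 1 i, (θs 0 - θs h)) • es 0) :
    ∃ k : F, k ≠ 0 ∧ k • (es 0 * e 0 * es 0) = (∑ i ∈ Finset.range (d + 1),
      (etaPoly d θ (d - i)).eval (θ 0) * (etaPoly d θs (d - i)).eval (θs 0) * ζ i) • es 0 := by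
  have hP : ∀ i ≤ d, ∏ h ∈ Finset.Icc 1 i, (θs 0 - θs h) ≠ 0 := by
    intro i hi
    rw [Finset.prod_ne_zero_iff]
    intro j hj
    have := Finset.mem_Icc.mp hj
    exact sub_ne_zero.mpr (hθs 0 j (by omega) (by omega) (by omega))
  set q : F[X] := ∏ j ∈ Finset.Ico 1 (d + 1), (X - C (θ j)) with hq
  have hq0 : q.eval (θ 0) ≠ 0 := by
    rw [hq, eval_prod, Finset.prod_ne_zero_iff]
    intro j hj
    have := Finset.mem_Ico.mp hj
    simpa [sub_eq_zero] using hθ 0 j (Nat.zero_le d) (by omega) (by omega)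
  have h1 : aeval (specOp d θ e) q = q.eval (θ 0) • e 0 := by
    rw [h.aeval_eq_sum, Finset.sum_eq_single 0]
    · intro k hk hk0
      rw [hq, eval_prod_X_sub_C_eq_zero (by omega) (by simpa using hk), zero_smul]
    · simp
  refine ⟨(∏ h ∈ Finset.Icc 1 d, (θs 0 - θs h)) * q.eval (θ 0), mul_ne_zero (hP d le_rfl) hq0, ?_⟩
  rw [mul_smul, ← smul_mul_assoc (q.eval (θ 0)), ← mul_smul_comm (q.eval (θ 0)), ← h1, hq, prod_X_sub_C_eq_sum_tauPoly, map_sum,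
    Finset.mul_sum, Finset.sum_mul, Finset.smul_sum, Finset.sum_smul]
  refine Finset.sum_congr rfl fun i hi => ?_
  have hi : i ≤ d := by simpa [Nat.lt_succ_iff] using hi
  have h2 : ∏ h ∈ Finset.Icc 1 d, (θs 0 - θs h) = (∏ h ∈ Finset.Icc 1 i, (θs 0 - θs h)) *
      (etaPoly d θs (d - i)).eval (θs 0) := by
    rw [etaPoly_sub_eq_prod_Ico θs hi, eval_prod]
    simp only [eval_sub, eval_X, eval_C]
    exact (Finset.prod_Ico_consecutive _ (by omega : 1 ≤ i + 1) (by omega)).symm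
  rw [map_mul, aeval_C, ← Algebra.smul_def, mul_smul_comm, smul_mul_assoc, hζ i hi, smul_smul,
    smul_smul, ← etaPoly_sub_eq_prod_Ico θ hi, h2]
  congr 1
  have := hP i hi
  field_simp

theorem zetaCond (h : TDRel d θ θs e es)
    (hθ : ∀ i j, i ≤ d → j ≤ d → i ≠ j → θ i ≠ θ j)
    (hθs : ∀ i j, i ≤ d → j ≤ d → i ≠ j → θs i ≠ θs j)
    (hζ : ∀ i, i ≤ d → es 0 * aeval (specOp d θ e) (tauPoly θ i) * es 0 =
      (ζ i / ∏ h ∈ Finset.Icc 1 i, (θs 0 - θs h)) • es 0)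
    (hes : es 0 ≠ 0) (h0 : es 0 * e 0 * es 0 ≠ 0) (hd : es 0 * e d * es 0 ≠ 0) :
    ZetaCond F d θ θs ζ := by
  refine ⟨?_, fun hζd => ?_, fun hS => ?_⟩
  · have h1 := hζ 0 (Nat.zero_le d)
    have h00 := h.es_mul 0 0 (Nat.zero_le d) (Nat.zero_le d)
    simp only [tauPoly, Finset.range_zero, Finset.prod_empty, map_one, mul_one, if_pos, h00,
      Finset.Icc_eq_empty_of_lt Nat.zero_lt_one, div_one] at h1
    exact (smul_left_injective F hes (by simpa using h1)).symm
  · obtain ⟨k, hk, hke⟩ := h.exists_smul_es_e_last_es hθ hθs hζ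
    rw [hζd, zero_smul] at hke
    exact hd ((smul_eq_zero.mp hke).resolve_left hk)
  · obtain ⟨k, hk, hke⟩ := h.exists_smul_es_e_zero_es hθ hθs hζ
    rw [hS, zero_smul] at hke
    exact h0 ((smul_eq_zero.mp hke).resolve_left hk)

theorem e_last_es_e_zero_ne_zero (h : TDRel d θ θs e es)
    (hθ : ∀ i j, i ≤ d → j ≤ d → i ≠ j → θ i ≠ θ j)
    (hθs : ∀ i j, i ≤ d → j ≤ d → i ≠ j → θs i ≠ θs j)
    (hζ : ∀ i, i ≤ d → es 0 * aeval (specOp d θ e) (tauPoly θ i) * es 0 =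
      (ζ i / ∏ h ∈ Finset.Icc 1 i, (θs 0 - θs h)) • es 0)
    (hes : es 0 ≠ 0) (hζc : ZetaCond F d θ θs ζ) : e d * es 0 * e 0 ≠ 0 := by
  intro h0
  obtain ⟨k, hk, hke⟩ := h.exists_smul_es_e_last_es hθ hθs hζ
  obtain ⟨l, hl, hle⟩ := h.exists_smul_es_e_zero_es hθ hθs hζ
  have h00 : es 0 * es 0 = es 0 := by simpa using h.es_mul 0 0 (Nat.zero_le d) (Nat.zero_le d)
  have h1 : es 0 * e d * es 0 * (es 0 * e 0 * es 0) = 0 := by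
    have : es 0 * e d * es 0 * (es 0 * e 0 * es 0) =
        es 0 * (e d * (es 0 * es 0) * e 0) * es 0 := by simp only [mul_assoc]
    rw [this, h00, h0, mul_zero, zero_mul]
  have h2 := congrArg₂ (· * ·) hke hle
  simp only [smul_mul_smul_comm, h1, h00, smul_zero] at h2
  exact (mul_ne_zero hζc.2.1 hζc.2.2) ((smul_eq_zero.mp h2.symm).resolve_right hes)

end TDRel

end SplitSequence

section TDSystem

variable {F : Type*} [Field F] {V : Type*} [AddCommGroup V] [Module F V] {d : ℕ}
  {θ θs ζ : ℕ → F}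

theorem map_range_le_iff {E : ℕ → Module.End F V} (B : Module.End F V)
    (hmul : ∀ i j, i ≤ d → j ≤ d → E i * E j = if i = j then E i else 0)
    (hsum : ∑ i ∈ Finset.range (d + 1), E i = 1) :
    (∀ i, i ≤ d → Submodule.map B (LinearMap.range (E i)) ≤
      (if i = 0 then ⊥ else LinearMap.range (E (i - 1))) ⊔ LinearMap.range (E i) ⊔
        (if i = d then ⊥ else LinearMap.range (E (i + 1)))) ↔
    ∀ i j, i ≤ d → j ≤ d → 1 < max (i - j) (j - i) → E i * B * E j = 0 := by
  have hker : ∀ i j, i ≤ d → j ≤ d → i ≠ j → LinearMap.range (E j) ≤ LinearMap.ker (E i) := by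
    rintro i j hi hj hij _ ⟨x, rfl⟩
    have := hmul i j hi hj
    rw [if_neg hij] at this
    exact LinearMap.congr_fun this x
  constructor
  · intro h i j hi hj hij
    refine LinearMap.ext fun x => ?_
    have hle : (if j = 0 then ⊥ else LinearMap.range (E (j - 1))) ⊔ LinearMap.range (E j) ⊔
        (if j = d then ⊥ else LinearMap.range (E (j + 1))) ≤ LinearMap.ker (E i) := by
      refine sup_le (sup_le ?_ (hker i j hi hj (by omega))) ?_
      · split_ifs
        · exact bot_le
        · exact hker _ _ hi (by omega) (by omega)
      · split_ifs
        · exact bot_le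
        · exact hker _ _ hi (by omega) (by omega)
    exact hle (h j hj ⟨E j x, ⟨x, rfl⟩, rfl⟩)
  · rintro h i hi _ ⟨_, ⟨x, rfl⟩, rfl⟩
    have : B (E i x) = ∑ j ∈ Finset.range (d + 1), E j (B (E i x)) := by
      rw [← LinearMap.sum_apply, hsum, Module.End.one_apply]
    rw [this]
    refine Submodule.sum_mem _ fun j hj => ?_
    have hj : j ≤ d := by simpa [Nat.lt_succ_iff] using hj
    by_cases hij : 1 < max (j - i) (i - j)
    · have h0 : E j (B (E i x)) = 0 := LinearMap.congr_fun (h j i hj hi hij) x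
      rw [h0]
      exact Submodule.zero_mem _
    · obtain rfl | rfl | rfl : j = i ∨ j = i + 1 ∨ i = j + 1 := by omega
      · exact Submodule.mem_sup_left (Submodule.mem_sup_right ⟨_, rfl⟩)
      · rw [if_neg (by omega : i ≠ d)]
        exact Submodule.mem_sup_right ⟨_, rfl⟩
      · rw [if_neg (Nat.succ_ne_zero j)]
        exact Submodule.mem_sup_left (Submodule.mem_sup_left ⟨_, rfl⟩)

theorem IsTDSystem.tdRel {A As : V →ₗ[F] V} {E Es : ℕ → (V →ₗ[F] V)}
    (h : IsTDSystem F V d A As E Es θ θs) :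
    TDRel (R := Module.End F V) d θ θs E Es ∧ A = specOp (R := Module.End F V) d θ E ∧
      As = specOp (R := Module.End F V) d θs Es := by
  obtain ⟨-, -, -, -, -, -, hE, hEs, hsE, hsEs, rfl, rfl, hAs, hA, -⟩ := h
  refine ⟨⟨hE, hEs, hsE, hsEs, ?_, ?_⟩, rfl, rfl⟩
  · intro i j hi hj k
    exact mul_pow_mul_eq_zero_of_adjacent _ hEs hsEs ((map_range_le_iff _ hEs hsEs).mp hA) k
      i j hi hj
  · intro i j hi hj k
    exact mul_pow_mul_eq_zero_of_adjacent _ hE hsE ((map_range_le_iff _ hE hsE).mp hAs) k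
      i j hi hj

theorem TDRel.isTDSystem [FiniteDimensional F V] [Nontrivial V] {E Es : ℕ → Module.End F V}
    (h : TDRel d θ θs E Es)
    (hθ : ∀ i j, i ≤ d → j ≤ d → i ≠ j → θ i ≠ θ j)
    (hθs : ∀ i j, i ≤ d → j ≤ d → i ≠ j → θs i ≠ θs j)
    (hE : ∀ i ≤ d, E i ≠ 0) (hEs : ∀ i ≤ d, Es i ≠ 0)
    (hirr : ∀ W : Submodule F V, (∀ w ∈ W, specOp d θ E w ∈ W) →
      (∀ w ∈ W, specOp d θs Es w ∈ W) → W = ⊥ ∨ W = ⊤) :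
    IsTDSystem F V d (specOp d θ E) (specOp d θs Es) E Es θ θs := by
  refine ⟨inferInstance, Module.finrank_pos, hθ, hθs, hE, hEs, h.e_mul, h.es_mul, h.sum_e,
    h.sum_es, rfl, rfl, (map_range_le_iff _ h.e_mul h.sum_e).mpr fun i j hi hj hij => ?_,
    (map_range_le_iff _ h.es_mul h.sum_es).mpr fun i j hi hj hij => ?_, hirr⟩
  · simpa using h.e_pow i j hi hj 1 hij
  · simpa using h.es_pow i j hi hj 1 hij

theorem IsTDSystem.irreducible {A As : V →ₗ[F] V} {E Es : ℕ → (V →ₗ[F] V)}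
    (h : IsTDSystem F V d A As E Es θ θs) :
    ∀ W : Submodule F V, (∀ w ∈ W, A w ∈ W) → (∀ w ∈ W, As w ∈ W) → W = ⊥ ∨ W = ⊤ := by
  obtain ⟨-, -, -, -, -, -, -, -, -, -, -, -, -, -, hirr⟩ := h
  exact hirr

theorem SharpTDWithArray.eigCond_and_zetaCond {A As : V →ₗ[F] V} {E Es : ℕ → (V →ₗ[F] V)}
    (h : SharpTDWithArray F V d A As E Es θ θs ζ) :
    EigCond F d θ θs ∧ ZetaCond F d θ θs ζ := by
  obtain ⟨h, -, hζ⟩ := h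
  have hirr := h.irreducible
  obtain ⟨hrel, rfl, rfl⟩ := h.tdRel
  obtain ⟨-, -, hθ, hθs, hE, hEs, -⟩ := h
  obtain ⟨h0, hd, hdd⟩ := hrel.triple_ne_zero hirr hE hEs
  exact ⟨hrel.eigCond hθ hθs hdd, hrel.zetaCond hθ hθs hζ (hEs 0 (Nat.zero_le d)) h0 hd⟩

end TDSystem

section TModules

variable {F : Type*} [Field F] {d : ℕ} {θ θs ζ : ℕ → F}

theorem map_specOp {R R' : Type*} [Ring R] [Algebra F R] [Ring R'] [Algebra F R']
    (ρ : R →ₐ[F] R') (η : ℕ → F) (x : ℕ → R) :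
    ρ (specOp d η x) = specOp d η (fun i => ρ (x i)) := by
  simp [specOp, map_sum]

/-- A subspace of a `T`-module that is invariant under `a` and `a*` is a submodule. -/
theorem apply_mem_of_invariant {V : Type*} [AddCommGroup V] [Module F V]
    (hθ : ∀ i j, i ≤ d → j ≤ d → i ≠ j → θ i ≠ θ j)
    (hθs : ∀ i j, i ≤ d → j ≤ d → i ≠ j → θs i ≠ θs j)
    (ρ : TAlg F d θ θs →ₐ[F] Module.End F V) (W : Submodule F V)
    (hA : ∀ w ∈ W, ρ (specOp d θ (eT F d θ θs)) w ∈ W)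
    (hAs : ∀ w ∈ W, ρ (specOp d θs (esT F d θ θs)) w ∈ W) (t : TAlg F d θ θs) :
    ∀ w ∈ W, ρ t w ∈ W := by
  have h := tdRel_TAlg F d θ θs
  have hpoly : ∀ (B : TAlg F d θ θs) (f : F[X]), (∀ w ∈ W, ρ B w ∈ W) →
      ∀ w ∈ W, ρ (aeval B f) w ∈ W := by
    intro B f hB
    induction f using Polynomial.induction_on with
    | C c =>
      intro w hw
      simpa [Module.algebraMap_end_apply] using W.smul_mem c hw
    | add p q hp hq =>
      intro w hw
      simpa using W.add_mem (hp w hw) (hq w hw)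
    | monomial n c ih =>
      intro w hw
      have := hB _ (ih w hw)
      rw [← Module.End.mul_apply, ← map_mul] at this
      rw [pow_succ', ← mul_assoc, mul_comm (C c), mul_assoc, map_mul, aeval_X]
      exact this
  have ht : t ∈ Algebra.adjoin F (eT F d θ θs '' Set.Iic d ∪ esT F d θ θs '' Set.Iic d) :=
    adjoin_idempotents_TAlg F d θ θs ▸ Algebra.mem_top
  induction ht using Algebra.adjoin_induction with
  | mem x hx =>
    rcases hx with ⟨i, hi, rfl⟩ | ⟨i, hi, rfl⟩
    · obtain ⟨f, hf⟩ := h.exists_aeval_eq hθ hi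
      exact hf ▸ hpoly _ f hA
    · obtain ⟨f, hf⟩ := h.swap.exists_aeval_eq hθs hi
      exact hf ▸ hpoly _ f hAs
  | algebraMap r =>
    intro w hw
    simpa [Module.algebraMap_end_apply] using W.smul_mem r hw
  | add x y _ _ hx hy =>
    intro w hw
    simpa using W.add_mem (hx w hw) (hy w hw)
  | mul x y _ _ hx hy =>
    intro w hw
    simpa using hx _ (hy w hw)

theorem exists_rep_apply_eq {V : Type*} [AddCommGroup V] [Module F V]
    (ρ : TAlg F d θ θs →ₐ[F] Module.End F V)
    (hirr : ∀ W : Submodule F V, (∀ w ∈ W, ρ (specOp d θ (eT F d θ θs)) w ∈ W) →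
      (∀ w ∈ W, ρ (specOp d θs (esT F d θ θs)) w ∈ W) → W = ⊥ ∨ W = ⊤)
    {w : V} (hw : w ≠ 0) (u : V) : ∃ t, ρ t w = u := by
  let f : TAlg F d θ θs →ₗ[F] V := (LinearMap.applyₗ w).comp ρ.toLinearMap
  have hinv : ∀ s, ∀ x ∈ LinearMap.range f, ρ s x ∈ LinearMap.range f := by
    rintro s _ ⟨t, rfl⟩
    exact ⟨s * t, by simp [f]⟩
  rcases hirr (LinearMap.range f) (hinv _) (hinv _) with h | h
  · have : w ∈ LinearMap.range f := ⟨1, by simp [f]⟩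
    rw [h] at this
    exact absurd this hw
  · have : u ∈ LinearMap.range f := h ▸ Submodule.mem_top
    exact this

theorem map_mu_eq_eval_smul {R : Type*} [Ring R] [Algebra F R]
    {μ : MvPolynomial (Fin d) F →ₗ[F] TAlg F d θ θs} (hμ : MuProps F d θ θs μ)
    (ρ : TAlg F d θ θs →ₐ[F] R) (c : Fin d → F)
    (hc : ∀ i : Fin d, ρ (esT F d θ θs 0 * aeval (specOp d θ (eT F d θ θs))
      (tauPoly θ ((i : ℕ) + 1)) * esT F d θ θs 0) = c i • ρ (esT F d θ θs 0))
    (p : MvPolynomial (Fin d) F) :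
    ρ (μ p) = MvPolynomial.eval c p • ρ (esT F d θ θs 0) := by
  have h0 := (tdRel_TAlg F d θ θs).es_mul 0 0 (Nat.zero_le d) (Nat.zero_le d)
  rw [if_pos rfl] at h0
  induction p using MvPolynomial.induction_on with
  | C a =>
    rw [MvPolynomial.eval_C, MvPolynomial.C_eq_smul_one, map_smul, map_smul, hμ.1]
  | add p q hp hq => rw [map_add, map_add, hp, hq, map_add, add_smul]
  | mul_X p i hp =>
    rw [hμ.2.1, map_mul, hp, hμ.2.2.1, aT_eq_specOp, hc, smul_mul_smul_comm, ← map_mul, h0,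
      map_mul (MvPolynomial.eval c), MvPolynomial.eval_X]

end TModules

section Uniqueness

variable {F : Type*} [Field F] {d : ℕ} {θ θs ζ : ℕ → F}

theorem SharpTDWithArray.exists_rep {V : Type*} [AddCommGroup V] [Module F V]
    {A As : V →ₗ[F] V} {E Es : ℕ → (V →ₗ[F] V)} (h : SharpTDWithArray F V d A As E Es θ θs ζ) :
    ∃ (ρ : TAlg F d θ θs →ₐ[F] Module.End F V) (v : V), v ≠ 0 ∧ Es 0 v = v ∧
      (∀ i ≤ d, ρ (eT F d θ θs i) = E i) ∧ (∀ i ≤ d, ρ (esT F d θ θs i) = Es i) ∧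
      ρ (specOp d θ (eT F d θ θs)) = A ∧ ρ (specOp d θs (esT F d θ θs)) = As ∧
      (∀ (w : V), w ≠ 0 → ∀ u, ∃ t, ρ t w = u) ∧
      ∀ i ≤ d, ρ (esT F d θ θs 0 * aeval (specOp d θ (eT F d θ θs)) (tauPoly θ i) *
        esT F d θ θs 0) = (ζ i / ∏ h ∈ Finset.Icc 1 i, (θs 0 - θs h)) • ρ (esT F d θ θs 0) := by
  obtain ⟨h, -, hζ⟩ := h
  have hirr := h.irreducible
  obtain ⟨hrel, hA, hAs⟩ := h.tdRel
  obtain ⟨-, -, hθ, hθs, -, hEs, -⟩ := h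
  obtain ⟨ρ, hρe, hρs⟩ := hrel.exists_algHom
  have hcongr : ∀ (η : ℕ → F) (x y : ℕ → Module.End F V), (∀ i ≤ d, x i = y i) →
      specOp d η x = specOp d η y := fun η x y hxy =>
    Finset.sum_congr rfl fun i hi => by rw [hxy i (by simpa [Nat.lt_succ_iff] using hi)]
  have hρA : ρ (specOp d θ (eT F d θ θs)) = A := by
    rw [map_specOp, hA]; exact hcongr _ _ _ hρe
  have hρAs : ρ (specOp d θs (esT F d θ θs)) = As := by
    rw [map_specOp, hAs]; exact hcongr _ _ _ hρs
  obtain ⟨x, hx⟩ : ∃ x, Es 0 x ≠ 0 := by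
    by_contra! hall
    exact hEs 0 (Nat.zero_le d) (LinearMap.ext hall)
  refine ⟨ρ, Es 0 x, hx, ?_, hρe, hρs, hρA, hρAs, fun w hw u => exists_rep_apply_eq ρ ?_ hw u, ?_⟩
  · have := hrel.es_mul 0 0 (Nat.zero_le d) (Nat.zero_le d)
    rw [if_pos rfl] at this
    exact LinearMap.congr_fun this x
  · rw [hρA, hρAs]
    exact hirr
  · intro i hi
    rw [map_mul, map_mul, ← aeval_algHom_apply, hρA, hρs 0 (Nat.zero_le d), mul_assoc]
    exact hζ i hi

theorem apply_eq_zero_iff_eval_eq_zero {W : Type*} [AddCommGroup W] [Module F W]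
    {μ : MvPolynomial (Fin d) F →ₗ[F] TAlg F d θ θs} (hμ : MuProps F d θ θs μ)
    {p : TAlg F d θ θs → MvPolynomial (Fin d) F}
    (hp : ∀ t, μ (p t) = esT F d θ θs 0 * t * esT F d θ θs 0)
    (ρ : TAlg F d θ θs →ₐ[F] Module.End F W) {w : W} (hw0 : w ≠ 0)
    (hw : ρ (esT F d θ θs 0) w = w) (hsurj : ∀ (w : W), w ≠ 0 → ∀ u, ∃ t, ρ t w = u)
    (hζ : ∀ i ≤ d, ρ (esT F d θ θs 0 * aeval (specOp d θ (eT F d θ θs)) (tauPoly θ i) *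
      esT F d θ θs 0) = (ζ i / ∏ h ∈ Finset.Icc 1 i, (θs 0 - θs h)) • ρ (esT F d θ θs 0))
    (t : TAlg F d θ θs) :
    ρ t w = 0 ↔ ∀ x, MvPolynomial.eval (fun i : Fin d =>
      ζ (i + 1) / ∏ h ∈ Finset.Icc 1 ((i : ℕ) + 1), (θs 0 - θs h)) (p (x * t)) = 0 := by
  have hx : ∀ x, ρ (esT F d θ θs 0) (ρ x (ρ t w)) = MvPolynomial.eval (fun i : Fin d =>
      ζ (i + 1) / ∏ h ∈ Finset.Icc 1 ((i : ℕ) + 1), (θs 0 - θs h)) (p (x * t)) • w := by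
    intro x
    have := map_mu_eq_eval_smul hμ ρ _ (fun i => hζ (i + 1) i.2) (p (x * t))
    rw [hp] at this
    have := LinearMap.congr_fun this w
    simpa [hw] using this
  constructor
  · intro ht x
    have := hx x
    rw [ht, map_zero, map_zero] at this
    exact (smul_eq_zero.mp this.symm).resolve_right hw0
  · intro hall
    by_contra ht
    obtain ⟨x, hxt⟩ := hsurj _ ht w
    have := hx x
    rw [hxt, hw, hall, zero_smul] at this
    exact hw0 this

/-- Two sharp tridiagonal systems with the same parameter array are isomorphic. -/
theorem SharpTDWithArray.exists_equiv {V V' : Type*} [AddCommGroup V] [Module F V]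
    [AddCommGroup V'] [Module F V'] {A As : V →ₗ[F] V} {E Es : ℕ → (V →ₗ[F] V)}
    {A' As' : V' →ₗ[F] V'} {E' Es' : ℕ → (V' →ₗ[F] V')}
    (h : SharpTDWithArray F V d A As E Es θ θs ζ)
    (h' : SharpTDWithArray F V' d A' As' E' Es' θ θs ζ) :
    ∃ σ : V ≃ₗ[F] V', (∀ v, σ (A v) = A' (σ v)) ∧ (∀ v, σ (As v) = As' (σ v)) ∧
      (∀ i, i ≤ d → ∀ v, σ (E i v) = E' i (σ v)) ∧
      (∀ i, i ≤ d → ∀ v, σ (Es i v) = Es' i (σ v)) := by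
  obtain ⟨hθ, hθs, -⟩ := h.eigCond_and_zetaCond.1
  obtain ⟨μ, hμ⟩ := exists_muProps hθ hθs
  obtain ⟨ρ, v, hv0, hv, hρe, hρs, hρA, hρAs, hsurj, hρζ⟩ := h.exists_rep
  obtain ⟨ρ', v', hv0', hv', hρe', hρs', hρA', hρAs', hsurj', hρζ'⟩ := h'.exists_rep
  choose p hp using es_mul_mul_es_zero_mem_range_of_muProps hμ
  let f : TAlg F d θ θs →ₗ[F] V := (LinearMap.applyₗ v).comp ρ.toLinearMap
  let f' : TAlg F d θ θs →ₗ[F] V' := (LinearMap.applyₗ v').comp ρ'.toLinearMap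
  have hker : LinearMap.ker f = LinearMap.ker f' := by
    ext t
    exact (apply_eq_zero_iff_eval_eq_zero hμ hp ρ hv0 (by rw [hρs 0 (Nat.zero_le d), hv]) hsurj hρζ t).trans
      (apply_eq_zero_iff_eval_eq_zero hμ hp ρ' hv0' (by rw [hρs' 0 (Nat.zero_le d), hv']) hsurj'
        hρζ' t).symm
  have hf : Function.Surjective f := hsurj v hv0
  have hf' : Function.Surjective f' := hsurj' v' hv0'
  let σ : V ≃ₗ[F] V' := (f.quotKerEquivOfSurjective hf).symm.trans
    ((Submodule.quotEquivOfEq _ _ hker).trans (f'.quotKerEquivOfSurjective hf'))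
  have hσ : ∀ t, σ (f t) = f' t := by
    intro t
    have : (f.quotKerEquivOfSurjective hf).symm (f t) = Submodule.Quotient.mk t := by
      rw [LinearEquiv.symm_apply_eq]; rfl
    simp only [σ, LinearEquiv.trans_apply, this]
    rfl
  have hint : ∀ t u, σ (ρ t u) = ρ' t (σ u) := by
    intro t u
    obtain ⟨s, rfl⟩ := hf u
    rw [hσ]
    have := hσ (t * s)
    simpa [f, f'] using this
  refine ⟨σ, ?_, ?_, fun i hi => ?_, fun i hi => ?_⟩
  · rw [← hρA, ← hρA']; exact hint _
  · rw [← hρAs, ← hρAs']; exact hint _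
  · rw [← hρe i hi, ← hρe' i hi]; exact hint _
  · rw [← hρs i hi, ← hρs' i hi]; exact hint _

end Uniqueness

section Existence

variable {F : Type*} [Field F] {d : ℕ} {θ θs ζ : ℕ → F}

/-- If `μ` is injective then `t ↦ e*_0 t e*_0` followed by evaluation is a linear functional. -/
theorem exists_functional {μ : MvPolynomial (Fin d) F →ₗ[F] TAlg F d θ θs}
    (hμ : MuProps F d θ θs μ) (hinj : Function.Injective μ) (c : Fin d → F) :
    ∃ χ : TAlg F d θ θs →ₗ[F] F, (∀ s t, χ (s * esT F d θ θs 0 * t) = χ s * χ t) ∧ χ 1 = 1 ∧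
      (∀ t, χ (t * esT F d θ θs 0) = χ t) ∧
      ∀ i : Fin d, χ (aeval (specOp d θ (eT F d θ θs)) (tauPoly θ ((i : ℕ) + 1))) = c i := by
  have h0 := (tdRel_TAlg F d θ θs).es_mul 0 0 (Nat.zero_le d) (Nat.zero_le d)
  rw [if_pos rfl] at h0
  obtain ⟨g, hg⟩ := LinearMap.exists_leftInverse_of_injective μ (LinearMap.ker_eq_bot.mpr hinj)
  have hgμ : ∀ p, g (μ p) = p := fun p => LinearMap.congr_fun hg p
  let χ : TAlg F d θ θs →ₗ[F] F := ((MvPolynomial.aeval c).toLinearMap.comp g).comp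
    ((LinearMap.mulLeft F (esT F d θ θs 0)).comp (LinearMap.mulRight F (esT F d θ θs 0)))
  have hχ : ∀ t p, μ p = esT F d θ θs 0 * t * esT F d θ θs 0 → χ t = MvPolynomial.eval c p := by
    intro t p hp
    have : χ t = MvPolynomial.aeval c (g (esT F d θ θs 0 * (t * esT F d θ θs 0))) := rfl
    rw [this, ← mul_assoc, ← hp, hgμ, MvPolynomial.aeval_eq_eval]
  choose p hp using es_mul_mul_es_zero_mem_range_of_muProps hμ
  refine ⟨χ, fun s t => ?_, ?_, fun t => ?_, fun i => ?_⟩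
  · rw [hχ s _ (hp s), hχ t _ (hp t), ← map_mul]
    refine hχ _ _ ?_
    rw [hμ.2.1, hp, hp]
    simp only [mul_assoc]
    rw [← mul_assoc (esT F d θ θs 0) (esT F d θ θs 0), h0]
  · rw [hχ 1 1 (by rw [hμ.1, mul_one, h0]), map_one]
  · rw [hχ t _ (hp t)]
    exact hχ _ _ (by rw [hp, mul_assoc, mul_assoc, mul_assoc, h0])
  · rw [hχ _ (MvPolynomial.X i) (by rw [hμ.2.2.1, aT_eq_specOp]), MvPolynomial.eval_X]

/-- The left ideal of all `t` such that `χ` vanishes on `T t`. -/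
def functionalRadical {R : Type*} [Ring R] [Algebra F R] (χ : R →ₗ[F] F) : Submodule R R where
  carrier := {t | ∀ x, χ (x * t) = 0}
  add_mem' := fun {s t} hs ht x => by rw [mul_add, map_add, hs, ht, add_zero]
  zero_mem' := fun x => by rw [mul_zero, map_zero]
  smul_mem' := fun r t ht x => by rw [smul_eq_mul, ← mul_assoc]; exact ht _

/-- If `μ` is injective, the conditions on the eigenvalues and the split sequence are sufficient
for the existence of a sharp tridiagonal system. -/
theorem exists_sharpTDWithArray (hE : EigCond F d θ θs) (hZ : ZetaCond F d θ θs ζ)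
    {μ : MvPolynomial (Fin d) F →ₗ[F] TAlg F d θ θs}
    (hμ : MuProps F d θ θs μ) (hinj : Function.Injective μ) :
    ∃ (K : Submodule (TAlg F d θ θs) (TAlg F d θ θs))
      (A As : (TAlg F d θ θs ⧸ K) →ₗ[F] (TAlg F d θ θs ⧸ K))
      (E Es : ℕ → ((TAlg F d θ θs ⧸ K) →ₗ[F] (TAlg F d θ θs ⧸ K))),
      SharpTDWithArray F (TAlg F d θ θs ⧸ K) d A As E Es θ θs ζ := by
  obtain ⟨hθ, hθs, -⟩ := hE
  have hT := tdRel_TAlg F d θ θs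
  obtain ⟨χ, hχm, hχ1, hχr, hχτ⟩ := exists_functional hμ hinj
    (fun i => ζ (i + 1) / ∏ h ∈ Finset.Icc 1 ((i : ℕ) + 1), (θs 0 - θs h))
  let K := functionalRadical χ
  let V := TAlg F d θ θs ⧸ K
  let f : TAlg F d θ θs →ₗ[F] V := K.mkQ.restrictScalars F
  let ρ : TAlg F d θ θs →ₐ[F] Module.End F V := Algebra.lsmul F F V
  have hρf : ∀ s t, ρ s (f t) = f (s * t) := fun s t => rfl
  have hfK : ∀ t, f t = 0 ↔ ∀ x, χ (x * t) = 0 := fun t => Submodule.Quotient.mk_eq_zero K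
  have hfsurj : Function.Surjective f := K.mkQ_surjective
  have hf1 : f 1 ≠ 0 := by
    rw [Ne, hfK]
    intro hall
    have := hall 1
    rw [mul_one, hχ1] at this
    exact one_ne_zero this
  have hfes : ∀ t, f (t * esT F d θ θs 0) = f t := by
    intro t
    rw [← sub_eq_zero, ← map_sub, hfK]
    intro x
    rw [mul_sub, map_sub, ← mul_assoc, hχr, sub_self]
  have hesf : ∀ t, f (esT F d θ θs 0 * t) = χ t • f 1 := by
    intro t
    rw [← sub_eq_zero, ← map_smul, ← map_sub, hfK]
    intro x
    rw [mul_sub, map_sub, ← mul_assoc, hχm, mul_smul_comm, map_smul, mul_one, smul_eq_mul,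
      mul_comm, sub_self]
  have hrel := hT.map ρ
  have hirr : ∀ W : Submodule F V, (∀ w ∈ W, specOp d θ (fun i => ρ (eT F d θ θs i)) w ∈ W) →
      (∀ w ∈ W, specOp d θs (fun i => ρ (esT F d θ θs i)) w ∈ W) → W = ⊥ ∨ W = ⊤ := by
    intro W hA hAs
    rw [← map_specOp] at hA hAs
    have hW := apply_mem_of_invariant hθ hθs ρ W hA hAs
    by_cases hbot : W = ⊥
    · exact Or.inl hbot
    · obtain ⟨w, hwW, hw0⟩ := Submodule.exists_mem_ne_zero_of_ne_bot hbot
      obtain ⟨t, rfl⟩ := hfsurj w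
      have : ∃ x, χ (x * t) ≠ 0 := by
        by_contra! hall
        exact hw0 ((hfK t).mpr hall)
      obtain ⟨x, hx⟩ := this
      have h1 := hW (esT F d θ θs 0 * x) _ hwW
      rw [hρf, mul_assoc, hesf] at h1
      have h2 : f 1 ∈ W := (Submodule.smul_mem_iff W hx).mp h1
      refine Or.inr (eq_top_iff.mpr fun u _ => ?_)
      obtain ⟨s, rfl⟩ := hfsurj u
      have := hW s _ h2
      rwa [hρf, mul_one] at this
  have hfin : FiniteDimensional F V := by
    let N := LinearMap.range μ
    have hN : FiniteDimensional F (N.map f) := by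
      refine Submodule.finiteDimensional_of_le (S₂ := Submodule.span F {f 1}) ?_
      rintro _ ⟨_, ⟨p, rfl⟩, rfl⟩
      rw [← TDRel.es_zero_mul_mu hμ.1 hμ.2.1 p, hesf]
      exact Submodule.smul_mem _ _ (Submodule.mem_span_singleton_self _)
    have hchain := fun r => finiteDimensional_map_chainSpan (d := d) (e := eT F d θ θs)
      (es := esT F d θ θs) N ρ f (fun s t => (hρf s t).symm) hN r
    have htop : (⊤ : Submodule F V) ≤ ⨆ r : Fin (d + 1),
        (chainSpan F d (eT F d θ θs) (esT F d θ θs) N r).map f := by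
      rintro u -
      obtain ⟨t, rfl⟩ := hfsurj u
      have : f t = ∑ r ∈ Finset.range (d + 1),
          f (esT F d θ θs r * t * esT F d θ θs 0) := by
        rw [← map_sum, ← Finset.sum_mul, ← Finset.sum_mul, hT.sum_es, one_mul, hfes]
      rw [this]
      refine Submodule.sum_mem _ fun r hr => ?_
      refine Submodule.mem_iSup_of_mem ⟨r, Finset.mem_range.mp hr⟩ ⟨_, ?_, rfl⟩
      exact hT.es_mul_mul_es_zero_mem_chainSpan hθ hθs hμ.1 hμ.2.1
        (fun i => by rw [hμ.2.2.1, aT_eq_specOp]) (adjoin_idempotents_TAlg F d θ θs) t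
        (Nat.lt_succ_iff.mp (Finset.mem_range.mp hr))
    have := Submodule.finiteDimensional_of_le htop
    exact Module.Finite.equiv (Submodule.topEquiv (R := F) (M := V))
  have hnt : Nontrivial V := ⟨f 1, 0, hf1⟩
  have hρes1 : ρ (esT F d θ θs 0) (f 1) = f 1 := by
    rw [hρf, hesf, hχ1]
    exact one_smul F (f 1)
  have hζ : ∀ i, i ≤ d → ρ (esT F d θ θs 0) *
      aeval (specOp d θ (fun i => ρ (eT F d θ θs i))) (tauPoly θ i) * ρ (esT F d θ θs 0) =
      (ζ i / ∏ h ∈ Finset.Icc 1 i, (θs 0 - θs h)) • ρ (esT F d θ θs 0) := by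
    intro i hi
    have hχi : χ (aeval (specOp d θ (eT F d θ θs)) (tauPoly θ i)) =
        ζ i / ∏ h ∈ Finset.Icc 1 i, (θs 0 - θs h) := by
      rcases i with - | i
      · simp [tauPoly, hχ1, hZ.1]
      · exact hχτ ⟨i, hi⟩
    rw [← map_specOp, aeval_algHom_apply, ← map_mul, ← map_mul]
    refine LinearMap.ext fun u => ?_
    obtain ⟨t, rfl⟩ := hfsurj u
    rw [LinearMap.smul_apply, hρf, hρf, hesf, mul_assoc, mul_assoc, hesf, ← mul_assoc, hχm, hχi]
    exact mul_smul (ζ i / ∏ h ∈ Finset.Icc 1 i, (θs 0 - θs h)) (χ t) (f 1)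
  have hes0 : ρ (esT F d θ θs 0) ≠ 0 := by
    intro h0
    rw [h0] at hρes1
    exact hf1 hρes1.symm
  have hne := hrel.e_last_es_e_zero_ne_zero hθ hθs hζ hes0 hZ
  refine ⟨K, _, _, _, _, hrel.isTDSystem hθ hθs (fun i hi => hrel.e_ne_zero hθs hne hi)
    (fun i hi => hrel.es_ne_zero hθs hne hi) hirr, ?_, hζ⟩
  have hrange : LinearMap.range (ρ (esT F d θ θs 0)) = Submodule.span F {f 1} := by
    refine le_antisymm ?_ ?_
    · rintro _ ⟨u, rfl⟩
      obtain ⟨t, rfl⟩ := hfsurj u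
      rw [hρf, hesf]
      exact Submodule.smul_mem _ _ (Submodule.mem_span_singleton_self _)
    · rw [Submodule.span_singleton_le_iff_mem]
      exact ⟨f 1, hρes1⟩
  rw [hrange]
  exact finrank_span_singleton hf1

end Existence

universe u

/-- The `μ`-conjecture implies the classification of tridiagonal systems over an
algebraically closed field: if `F` is algebraically closed and for all `d, θ, θs`
satisfying (i), (iii) the map `μ` is an isomorphism, then for all scalars `(θ; θs; ζ)`
there exists a tridiagonal system over `F` with parameter array `(θ; θs; ζ)` if and only
if (i), (ii), (iii) hold; moreover if (i)-(iii) hold then such a system is unique up to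
isomorphism of tridiagonal systems.  (Every tridiagonal system over an algebraically
closed field is sharp, so its parameter array is defined.) -/
theorem stmt18 {F : Type u} [Field F] [IsAlgClosed F]
    (hmu : ∀ (d : ℕ) (θ θs : ℕ → F), EigCond F d θ θs →
      ∀ μ : MvPolynomial (Fin d) F →ₗ[F] TAlg F d θ θs, MuProps F d θ θs μ →
        Function.Injective μ)
    (d : ℕ) (θ θs ζ : ℕ → F) :
    ((∃ (V : Type u) (_ : AddCommGroup V) (_ : Module F V)
        (A As : V →ₗ[F] V) (E Es : ℕ → (V →ₗ[F] V)),
        SharpTDWithArray F V d A As E Es θ θs ζ) ↔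
      (EigCond F d θ θs ∧ ZetaCond F d θ θs ζ)) ∧
    (EigCond F d θ θs → ZetaCond F d θ θs ζ →
      ∀ (V : Type u) (_ : AddCommGroup V) (_ : Module F V)
        (V' : Type u) (_ : AddCommGroup V') (_ : Module F V')
        (A As : V →ₗ[F] V) (E Es : ℕ → (V →ₗ[F] V))
        (A' As' : V' →ₗ[F] V') (E' Es' : ℕ → (V' →ₗ[F] V')),
      SharpTDWithArray F V d A As E Es θ θs ζ →
      SharpTDWithArray F V' d A' As' E' Es' θ θs ζ →
      ∃ σ : V ≃ₗ[F] V',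
        (∀ v, σ (A v) = A' (σ v)) ∧ (∀ v, σ (As v) = As' (σ v)) ∧
        (∀ i, i ≤ d → ∀ v, σ (E i v) = E' i (σ v)) ∧
        (∀ i, i ≤ d → ∀ v, σ (Es i v) = Es' i (σ v))) := by
  refine ⟨⟨?_, ?_⟩, ?_⟩
  · rintro ⟨V, _, _, A, As, E, Es, h⟩
    exact h.eigCond_and_zetaCond
  · rintro ⟨hE, hZ⟩
    obtain ⟨μ, hμ⟩ := exists_muProps hE.1 hE.2.1
    obtain ⟨K, A, As, E, Es, h⟩ := exists_sharpTDWithArray hE hZ hμ (hmu d θ θs hE μ hμ)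
    exact ⟨TAlg F d θ θs ⧸ K, inferInstance, inferInstance, A, As, E, Es, h⟩
  · intro _ _ V _ _ V' _ _ A As E Es A' As' E' Es' h h'
    exact h.exists_equiv h'
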